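/- arXiv:1010.4859 — 7 statements merged into one kernel-verified Lean document; each statement's English description precedes it below -/
import Mathlib

section
/- Let f ∈ 𝒮_e(ℝ²) with f ≥ 0 and f(x₀,y₀) > 0 for some (x₀,y₀) ∈ ℝ², and let g = Rf. Then the nonnegative function z ↦ g(z, √((z−x₀)² + y₀²)) has infinite Lebesgue integral over ℝ, i.e. ∫_ℝ g(z, √((z−x₀)² + y₀²)) dz = +∞. (Hence the operator (R*g)(x,y) = ∫_ℝ g(z, √((z−x)²+y²)) dz is not defined on such data, so Fawcett's reconstruction formula cannot be applied to nonnegative nonzero reflectivity functions.) -/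
open MeasureTheory Metric Real Filter

noncomputable section

/-- Spherical (circular) Radon transform in dimension `n = 1` for real-valued functions:
`(Rf)(x,r) = (1/(2π)) ∫_{S¹} f(x+rξ, rη) dS₁(ξ,η)`, the circle integral written
via the arclength parametrization `(ξ,η) = (cos θ, sin θ)`. -/
def circleRadonR (f : ℝ × ℝ → ℝ) (x r : ℝ) : ℝ :=
  (1 / (2 * π)) * ∫ θ in (0 : ℝ)..(2 * π), f (x + r * Real.cos θ, r * Real.sin θ)

/-- A circle of radius `r ≥ δ > 0` through `p` has an arc of length `δ` inside the closed
`δ`-ball around `p`, which bounds the circle mean of a nonnegative function from below. -/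
theorem le_circleRadonR_of_le_on_closedBall {f : ℝ × ℝ → ℝ} (hf : Continuous f)
    (hnonneg : ∀ p, 0 ≤ f p) {p : ℝ × ℝ} {c δ x r : ℝ} (hδ : 0 < δ)
    (hc : ∀ q ∈ closedBall p δ, c ≤ f q) (hr : r = √((x - p.1) ^ 2 + p.2 ^ 2)) (hδr : δ ≤ r) :
    1 / (2 * π) * (c * δ / r) ≤ circleRadonR f x r := by
  have hrpos : 0 < r := hδ.trans_le hδr
  obtain ⟨φ, hcos, hsin⟩ : ∃ φ : ℝ, r * cos φ = p.1 - x ∧ r * sin φ = p.2 := by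
    have hnorm : ‖(⟨p.1 - x, p.2⟩ : ℂ)‖ = r := by
      rw [Complex.norm_def, Complex.normSq_mk, hr]
      congr 1
      ring
    refine ⟨Complex.arg ⟨p.1 - x, p.2⟩, ?_, ?_⟩
    · rw [← hnorm, Complex.norm_mul_cos_arg]
    · rw [← hnorm, Complex.norm_mul_sin_arg]
  set F : ℝ → ℝ := fun θ => f (x + r * cos θ, r * sin θ) with hF
  have hFc : Continuous F := by fun_prop
  have hper : Function.Periodic F (2 * π) := fun θ => by simp [hF]
  have hshift : ∫ θ in (0 : ℝ)..(2 * π), F θ = ∫ θ in φ..(φ + 2 * π), F θ := by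
    simpa using hper.intervalIntegral_add_eq 0 φ
  have hdiv : 0 ≤ δ / r := by positivity
  have hdiv_le : δ / r ≤ 2 * π :=
    ((div_le_one hrpos).2 hδr).trans (by linarith [pi_gt_three])
  have harc : c * δ / r ≤ ∫ θ in φ..(φ + δ / r), F θ := by
    have hconst : ∫ _ in φ..(φ + δ / r), c = c * δ / r := by
      rw [intervalIntegral.integral_const, smul_eq_mul]
      ring
    rw [← hconst]
    refine intervalIntegral.integral_mono_on (by linarith) intervalIntegrable_const
      (hFc.intervalIntegrable _ _) fun θ hθ => hc _ ?_
    have hθφ : r * |θ - φ| ≤ δ := by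
      rw [abs_of_nonneg (by linarith [hθ.1]), mul_comm, ← le_div_iff₀ hrpos]
      linarith [hθ.2]
    rw [mem_closedBall, Prod.dist_eq, max_le_iff, Real.dist_eq, Real.dist_eq]
    constructor
    · calc |x + r * cos θ - p.1| = r * |cos θ - cos φ| := by
            rw [← abs_of_pos hrpos, ← abs_mul, abs_of_pos hrpos, mul_sub, hcos]
            congr 1
            ring
        _ ≤ r * |θ - φ| := mul_le_mul_of_nonneg_left (abs_cos_sub_cos_le θ φ) hrpos.le
        _ ≤ δ := hθφ
    · calc |r * sin θ - p.2| = r * |sin θ - sin φ| := by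
            rw [← abs_of_pos hrpos, ← abs_mul, abs_of_pos hrpos, mul_sub, hsin]
        _ ≤ r * |θ - φ| := mul_le_mul_of_nonneg_left (abs_sin_sub_sin_le θ φ) hrpos.le
        _ ≤ δ := hθφ
  have hmono : ∫ θ in φ..(φ + δ / r), F θ ≤ ∫ θ in φ..(φ + 2 * π), F θ :=
    intervalIntegral.integral_mono_interval le_rfl (by linarith) (by linarith)
      (Eventually.of_forall fun _ => hnonneg _) (hFc.intervalIntegrable _ _)
  unfold circleRadonR
  rw [hshift]
  gcongr
  exact harc.trans hmono

theorem lintegral_Ioi_ofReal_const_mul_inv {K B : ℝ} (hK : 0 < K) (hB : 0 ≤ B) :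
    ∫⁻ t in Set.Ioi B, ENNReal.ofReal (K * t⁻¹) = ⊤ := by
  by_contra h
  have hint : IntegrableOn (fun t : ℝ => K * t⁻¹) (Set.Ioi B) := by
    refine (lintegral_ofReal_ne_top_iff_integrable (by fun_prop) ?_).1 h
    filter_upwards [ae_restrict_mem measurableSet_Ioi] with t ht
    have : 0 < t := hB.trans_lt ht
    simp only [Pi.zero_apply]
    positivity
  refine not_integrableOn_Ioi_inv (a := B) ?_
  simpa [IntegrableOn, hK.ne'] using Integrable.const_mul hint K⁻¹

/-- **Divergence of the backprojection integral for nonnegative data.**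
If `f ∈ 𝒮_e(ℝ²)` is nonnegative with `f(x₀,y₀) > 0`, and `g = Rf`, then
`∫_ℝ g(z, √((z-x₀)² + y₀²)) dz = +∞`. -/
theorem stmt1 (f : SchwartzMap (ℝ × ℝ) ℝ)
    (heven : ∀ x y : ℝ, f (x, -y) = f (x, y))
    (hnonneg : ∀ p : ℝ × ℝ, 0 ≤ f p)
    (x₀ y₀ : ℝ) (hpos : 0 < f (x₀, y₀)) :
    ∫⁻ z : ℝ,
        ENNReal.ofReal
          (circleRadonR (fun p => f p) z (Real.sqrt ((z - x₀) ^ 2 + y₀ ^ 2))) = ⊤ := by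
  have hcont : Continuous fun p => f p := f.continuous
  obtain ⟨δ, hδ, hball⟩ : ∃ δ > 0, ∀ q ∈ closedBall (x₀, y₀) δ, f (x₀, y₀) / 2 ≤ f q :=
    nhds_basis_closedBall.mem_iff.1 <|
      hcont.continuousAt.eventually (eventually_ge_nhds (half_lt_self hpos))
  set c := f (x₀, y₀) / 2
  have hc : 0 < c := half_pos hpos
  set K := 1 / (2 * π) * (c * δ / 2) with hK_def
  have hK : 0 < K := by positivity
  have hB : 0 ≤ δ + |y₀| := by positivity
  rw [← lintegral_add_right_eq_self _ x₀, eq_top_iff,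
    ← lintegral_Ioi_ofReal_const_mul_inv hK hB]
  refine (setLIntegral_mono' measurableSet_Ioi fun t ht => ENNReal.ofReal_le_ofReal ?_).trans
    (setLIntegral_le_lintegral _ _)
  have ht' : δ + |y₀| < t := ht
  have hy : 0 ≤ |y₀| := abs_nonneg y₀
  have htpos : 0 < t := hB.trans_lt ht
  set r := √((t + x₀ - x₀) ^ 2 + y₀ ^ 2) with hr
  have htr : t ≤ r := Real.le_sqrt_of_sq_le (by nlinarith [sq_nonneg y₀])
  have hrt : r ≤ 2 * t := by
    refine Real.sqrt_le_iff.2 ⟨by positivity, ?_⟩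
    nlinarith [sq_abs y₀]
  have hrpos : 0 < r := htpos.trans_le htr
  calc K * t⁻¹ = 1 / (2 * π) * (c * δ / (2 * t)) := by
        rw [hK_def]
        field_simp
    _ ≤ 1 / (2 * π) * (c * δ / r) := by gcongr
    _ ≤ circleRadonR (fun p => f p) (t + x₀) r :=
        le_circleRadonR_of_le_on_closedBall hcont hnonneg hδ hball hr (by linarith)
end
end

section
/- Let n ≥ 1, let f ∈ 𝒟_e(ℝ^{n+1}), and let g = Rf. Then for every (x,y) ∈ ℝⁿ×ℝ the function z ↦ (∂/∂y)[ g(z, √(‖x−z‖²+y²)) ] is absolutely integrable on ℝⁿ, so (R*_∂ g)(x,y) is well defined; moreover there is a constant C > 0 (depending only on f) such that |(R*_∂ g)(x,y)| ≤ C for all (x,y) ∈ ℝⁿ×ℝ, i.e. R*_∂ g ∈ L^∞(ℝⁿ×ℝ). -/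
open MeasureTheory Metric Real Filter

noncomputable section

/-- Total surface measure |Sⁿ| of the unit sphere Sⁿ ⊂ ℝ^{n+1}. -/
def sphVol (n : ℕ) : ℝ :=
  ((volume : Measure (EuclideanSpace ℝ (Fin (n + 1)))).toSphere Set.univ).toReal

/-- Spherical Radon transform:
`(Rf)(x,r) = (1/|Sⁿ|) ∫_{Sⁿ} f(x + rξ, rη) dSₙ(ξ,η)`, where a point `p` of the unit
sphere in ℝ^{n+1} is split as `p = (ξ, η)` with `ξ ∈ ℝⁿ` its first `n` coordinates and
`η ∈ ℝ` its last coordinate. -/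
def sphereRadon (n : ℕ) (f : EuclideanSpace ℝ (Fin n) × ℝ → ℂ)
    (x : EuclideanSpace ℝ (Fin n)) (r : ℝ) : ℂ :=
  (((sphVol n)⁻¹ : ℝ) : ℂ) *
    ∫ p : sphere (0 : EuclideanSpace ℝ (Fin (n + 1))) 1,
      f (x + r • ((EuclideanSpace.equiv (Fin n) ℝ).symm
              fun i : Fin n => (p : EuclideanSpace ℝ (Fin (n + 1))) i.castSucc),
         r * (p : EuclideanSpace ℝ (Fin (n + 1))) (Fin.last n))
      ∂((volume : Measure (EuclideanSpace ℝ (Fin (n + 1)))).toSphere)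


/-- The modified backprojection operator
`(R*_∂ g)(x,y) := ∫_{ℝⁿ} ∂/∂y [ g(z, √(‖x-z‖²+y²)) ] dz`. -/
def RstarPartial (n : ℕ) (g : EuclideanSpace ℝ (Fin n) → ℝ → ℂ)
    (x : EuclideanSpace ℝ (Fin n)) (y : ℝ) : ℂ :=
  ∫ z : EuclideanSpace ℝ (Fin n),
    deriv (fun y' : ℝ => g z (Real.sqrt (‖x - z‖ ^ 2 + y' ^ 2))) y

/-- The part of the unit sphere that the dilation by `r` maps into a ball of radius `A` has
surface measure `O(r ^ (1 - dim E))`, uniformly in the centre of the ball. -/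
theorem toSphere_real_smul_mem_closedBall_mul_pow_le {E : Type*} [NormedAddCommGroup E]
    [NormedSpace ℝ E] [FiniteDimensional ℝ E] [MeasurableSpace E] [BorelSpace E]
    (μ : Measure E) [μ.IsAddHaarMeasure] (c : E) (A : ℝ) {r : ℝ} (hr : 0 < r) :
    μ.toSphere.real {ω : sphere (0 : E) 1 | r • (ω : E) ∈ closedBall c A} *
      r ^ (Module.finrank ℝ E - 1) ≤ μ.real (closedBall 0 (A + 1)) := by
  set S : Set (sphere (0 : E) 1) := {ω | r • (ω : E) ∈ closedBall c A} with hS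
  set k := Module.finrank ℝ E - 1
  set J : Set (Set.Ioi (0 : ℝ)) := {t | (t : ℝ) ∈ Set.Ioc r (r + 1)} with hJ
  have hJm : MeasurableSet J := measurableSet_Ioc.preimage measurable_subtype_coe
  have hSm : MeasurableSet S :=
    (isClosed_closedBall.preimage (by fun_prop : Continuous
      fun ω : sphere (0 : E) 1 => r • (ω : E))).measurableSet
  have hJvol : ENNReal.ofReal (r ^ k) ≤ Measure.volumeIoiPow k J := by
    rw [Measure.volumeIoiPow, withDensity_apply _ hJm,
      setLIntegral_subtype measurableSet_Ioi _ fun a : ℝ ↦ .ofReal (a ^ k)]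
    have himg : Set.image Subtype.val J = Set.Ioc r (r + 1) := by
      ext t
      simp only [hJ, Set.mem_image, Set.mem_ofPred_eq]
      exact ⟨fun ⟨u, hu, hut⟩ => hut ▸ hu, fun ht => ⟨⟨t, hr.trans ht.1⟩, ht, rfl⟩⟩
    rw [himg]
    calc ENNReal.ofReal (r ^ k) = ∫⁻ _ in Set.Ioc r (r + 1), ENNReal.ofReal (r ^ k) := by simp
      _ ≤ _ := setLIntegral_mono' measurableSet_Ioc fun t ht =>
        ENNReal.ofReal_le_ofReal (pow_le_pow_left₀ hr.le ht.1.le _)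
  have hcone : μ.toSphere S * Measure.volumeIoiPow k J ≤ μ (closedBall 0 (A + 1)) := by
    rw [← Measure.prod_prod, ← μ.measurePreserving_homeomorphUnitSphereProd.measure_preimage
      (hSm.prod hJm).nullMeasurableSet, comap_subtype_coe_apply (measurableSet_singleton 0).compl,
      ← Measure.addHaar_closedBall_center μ c]
    refine measure_mono ?_
    rintro _ ⟨v, ⟨hvS, hvJ⟩, rfl⟩
    set ω := (homeomorphUnitSphereProd E v).1
    set t := (homeomorphUnitSphereProd E v).2
    have hv : (v : E) = (t : ℝ) • (ω : E) := by
      have h := (homeomorphUnitSphereProd E).symm_apply_apply v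
      rw [← homeomorphUnitSphereProd_symm_apply_coe, h]
    have hω : ‖(ω : E)‖ = 1 := norm_eq_of_mem_sphere ω
    simp only [hS, Set.mem_ofPred_eq, mem_closedBall, dist_eq_norm] at hvS
    rw [mem_closedBall, dist_eq_norm, hv]
    calc ‖(t : ℝ) • (ω : E) - c‖ = ‖(r • (ω : E) - c) + ((t : ℝ) - r) • (ω : E)‖ := by
          congr 1; module
      _ ≤ ‖r • (ω : E) - c‖ + ‖((t : ℝ) - r) • (ω : E)‖ := norm_add_le _ _
      _ ≤ A + 1 := by
        rw [norm_smul, hω, mul_one, Real.norm_of_nonneg (sub_nonneg.2 hvJ.1.le)]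
        linarith [hvJ.2, hvS]
  have h := (mul_le_mul_right hJvol _).trans hcone
  have h' := ENNReal.toReal_mono measure_closedBall_lt_top.ne h
  rwa [ENNReal.toReal_mul, ENNReal.toReal_ofReal (by positivity)] at h'

/-- Spherical means of a `C¹` function `h` whose derivative is bounded and vanishes outside a ball
of radius `A` are differentiable in the radius, with derivative `O(r ^ (1 - dim E))`. -/
theorem exists_hasDerivAt_integral_toSphere_smul {E F : Type*} [NormedAddCommGroup E]
    [NormedSpace ℝ E] [FiniteDimensional ℝ E] [MeasurableSpace E] [BorelSpace E]
    [NormedAddCommGroup F] [NormedSpace ℝ F] [CompleteSpace F]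
    (μ : Measure E) [μ.IsAddHaarMeasure] {h : E → F} (hh : ContDiff ℝ 1 h) {M A : ℝ} {c : E}
    (hM : ∀ p, ‖fderiv ℝ h p‖ ≤ M) (hA : ∀ p, p ∉ closedBall c A → fderiv ℝ h p = 0)
    {r : ℝ} (hr : 0 < r) :
    ∃ D : F, HasDerivAt (fun s : ℝ => ∫ ω : sphere (0 : E) 1, h (s • (ω : E)) ∂μ.toSphere) D r ∧
      ‖D‖ * r ^ (Module.finrank ℝ E - 1) ≤ M * μ.real (closedBall 0 (A + 1)) := by
  have hM0 : 0 ≤ M := (norm_nonneg _).trans (hM 0)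
  have hbound : ∀ (s : ℝ) (ω : sphere (0 : E) 1),
      ‖fderiv ℝ h (s • (ω : E)) ω‖ ≤ ‖fderiv ℝ h (s • (ω : E))‖ := fun s ω => by
    simpa using (fderiv ℝ h (s • (ω : E))).le_opNorm (ω : E)
  have hcont : Continuous fun ω : sphere (0 : E) 1 => fderiv ℝ h (r • (ω : E)) ω :=
    ((hh.continuous_fderiv one_ne_zero).comp (by fun_prop)).clm_apply continuous_subtype_val
  have hc : ∀ s : ℝ, Continuous fun ω : sphere (0 : E) 1 => h (s • (ω : E)) := fun s =>
    hh.continuous.comp (by fun_prop)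
  have key := hasDerivAt_integral_of_dominated_loc_of_deriv_le (μ := μ.toSphere) (x₀ := r)
    (F := fun s (ω : sphere (0 : E) 1) => h (s • (ω : E)))
    (F' := fun s ω => fderiv ℝ h (s • (ω : E)) ω) (bound := fun _ => M) (s := Set.univ)
    Filter.univ_mem (.of_forall fun s => (hc s).aestronglyMeasurable)
    ((hc r).integrable_of_hasCompactSupport (.of_compactSpace _)) hcont.aestronglyMeasurable
    (.of_forall fun ω s _ => (hbound s ω).trans (hM _)) (integrable_const _)
    (.of_forall fun ω s _ => by
      have h1 : HasDerivAt (fun s : ℝ => s • (ω : E)) (ω : E) s := by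
        simpa using (hasDerivAt_id s).smul_const (ω : E)
      exact ((hh.differentiable one_ne_zero _).hasFDerivAt).comp_hasDerivAt s h1)
  refine ⟨_, key.2, ?_⟩
  set S : Set (sphere (0 : E) 1) := {ω | r • (ω : E) ∈ closedBall c A} with hS
  have hSm : MeasurableSet S :=
    (isClosed_closedBall.preimage (by fun_prop : Continuous
      fun ω : sphere (0 : E) 1 => r • (ω : E))).measurableSet
  have hle : ‖∫ ω : sphere (0 : E) 1, fderiv ℝ h (r • (ω : E)) ω ∂μ.toSphere‖
      ≤ M * μ.toSphere.real S := by
    calc _ ≤ ∫ ω, S.indicator (fun _ => M) ω ∂μ.toSphere := by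
          refine norm_integral_le_of_norm_le ((integrable_const M).indicator hSm)
            (.of_forall fun ω => ?_)
          by_cases hω : ω ∈ S
          · rw [Set.indicator_of_mem hω]
            exact (hbound r ω).trans (hM _)
          · rw [Set.indicator_of_notMem hω, hA _ hω]
            simp
      _ = M * μ.toSphere.real S := by
          rw [integral_indicator hSm, setIntegral_const, smul_eq_mul, mul_comm]
  calc _ ≤ M * μ.toSphere.real S * r ^ (Module.finrank ℝ E - 1) := by gcongr
    _ = M * (μ.toSphere.real S * r ^ (Module.finrank ℝ E - 1)) := mul_assoc _ _ _
    _ ≤ _ := mul_le_mul_of_nonneg_left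
      (toSphere_real_smul_mem_closedBall_mul_pow_le μ c A hr) hM0

/-- The splitting `ℝⁿ⁺¹ ≃ ℝⁿ × ℝ` separating the last coordinate. -/
def splitLast (n : ℕ) : EuclideanSpace ℝ (Fin (n + 1)) ≃L[ℝ] EuclideanSpace ℝ (Fin n) × ℝ :=
  LinearEquiv.toContinuousLinearEquiv
    { toFun := fun p => ((EuclideanSpace.equiv (Fin n) ℝ).symm fun i => p i.castSucc,
        p (Fin.last n))
      invFun := fun q => (EuclideanSpace.equiv (Fin (n + 1)) ℝ).symm
        (Fin.snoc (α := fun _ => ℝ) (fun i => q.1 i) q.2)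
      map_add' := fun _ _ => rfl
      map_smul' := fun _ _ => rfl
      left_inv := fun p => by
        ext i
        refine Fin.lastCases ?_ (fun j => ?_) i <;> simp
      right_inv := fun q => by
        ext i <;> simp }

theorem sphereRadon_eq_splitLast (n : ℕ) (f : EuclideanSpace ℝ (Fin n) × ℝ → ℂ)
    (x : EuclideanSpace ℝ (Fin n)) (r : ℝ) :
    sphereRadon n f x r = (((sphVol n)⁻¹ : ℝ) : ℂ) *
      ∫ p : sphere (0 : EuclideanSpace ℝ (Fin (n + 1))) 1,
        f ((x, 0) + splitLast n (r • (p : EuclideanSpace ℝ (Fin (n + 1)))))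
        ∂((volume : Measure (EuclideanSpace ℝ (Fin (n + 1)))).toSphere) := by
  have h : ∀ p : EuclideanSpace ℝ (Fin (n + 1)), (x, (0 : ℝ)) + splitLast n (r • p) =
      (x + r • ((EuclideanSpace.equiv (Fin n) ℝ).symm fun i : Fin n => p i.castSucc),
        r * p (Fin.last n)) := fun p => by
    rw [map_smul, ← zero_add (r * p (Fin.last n))]
    rfl
  simp only [h, sphereRadon]

theorem continuous_sphereRadon {n : ℕ} {f : EuclideanSpace ℝ (Fin n) × ℝ → ℂ}
    (hf : Continuous f) :
    Continuous fun q : EuclideanSpace ℝ (Fin n) × ℝ => sphereRadon n f q.1 q.2 := by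
  simp only [sphereRadon_eq_splitLast]
  refine continuous_const.mul ?_
  have h := continuous_parametric_integral_of_continuous
    (μ := (volume : Measure (EuclideanSpace ℝ (Fin (n + 1)))).toSphere)
    (f := fun (q : EuclideanSpace ℝ (Fin n) × ℝ)
      (p : sphere (0 : EuclideanSpace ℝ (Fin (n + 1))) 1) =>
      f ((q.1, 0) + splitLast n (q.2 • (p : EuclideanSpace ℝ (Fin (n + 1))))))
    (hf.comp (by fun_prop)) isCompact_univ
  simpa using h

/-- The radial derivative of the spherical Radon transform is `O(r ^ (-n))`, uniformly in the
centre. -/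
theorem exists_hasDerivAt_sphereRadon {n : ℕ} {f : EuclideanSpace ℝ (Fin n) × ℝ → ℂ}
    (hf : ContDiff ℝ 1 f) (hsupp : HasCompactSupport f) :
    ∃ K : ℝ, 0 ≤ K ∧ ∀ (x : EuclideanSpace ℝ (Fin n)) (r : ℝ), 0 < r →
      ∃ D : ℂ, HasDerivAt (sphereRadon n f x) D r ∧ ‖D‖ * r ^ n ≤ K := by
  obtain ⟨M, hM⟩ := (hsupp.fderiv ℝ).exists_bound_of_continuous (hf.continuous_fderiv one_ne_zero)
  obtain ⟨A, hA⟩ := hsupp.isCompact.isBounded.subset_closedBall 0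
  have hM0 : 0 ≤ M := (norm_nonneg _).trans (hM 0)
  set T := splitLast n
  let T₁ := T.toContinuousLinearMap
  let T₂ := T.symm.toContinuousLinearMap
  set B : ℝ := ‖T₂‖ * A
  set K₀ : ℝ := M * ‖T₁‖ *
    (volume : Measure (EuclideanSpace ℝ (Fin (n + 1)))).real (closedBall 0 (B + 1))
  refine ⟨|(sphVol n)⁻¹| * K₀, by positivity, fun x r hr => ?_⟩
  have hfd : ∀ p, HasFDerivAt (fun p => f ((x, 0) + T p))
      ((fderiv ℝ f ((x, 0) + T p)).comp T₁) p := fun p =>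
    (hf.differentiable one_ne_zero _).hasFDerivAt.comp p (T₁.hasFDerivAt.const_add _)
  obtain ⟨D, hD, hDK⟩ := exists_hasDerivAt_integral_toSphere_smul
    (volume : Measure (EuclideanSpace ℝ (Fin (n + 1))))
    (h := fun p => f ((x, 0) + T p)) (hf.comp (contDiff_const.add T.contDiff))
    (M := M * ‖T₁‖) (A := B) (c := -T.symm (x, 0))
    (fun p => by
      rw [(hfd p).fderiv]
      exact (ContinuousLinearMap.opNorm_comp_le _ _).trans
        (mul_le_mul_of_nonneg_right (hM _) (norm_nonneg _)))
    (fun p hp => by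
      rw [(hfd p).fderiv]
      have hnot : (x, (0 : ℝ)) + T p ∉ tsupport f := fun hmem => hp (by
        have hle : ‖(x, (0 : ℝ)) + T p‖ ≤ A := by simpa using hA hmem
        rw [mem_closedBall, dist_eq_norm]
        calc ‖p - -T.symm (x, 0)‖ = ‖T₂ ((x, 0) + T p)‖ := by
              simp [T₂, add_comm]
          _ ≤ ‖T₂‖ * ‖(x, (0 : ℝ)) + T p‖ := T₂.le_opNorm _
          _ ≤ B := mul_le_mul_of_nonneg_left hle (norm_nonneg _))
      rw [image_eq_zero_of_notMem_tsupport fun h => hnot (tsupport_fderiv_subset ℝ h)]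
      simp)
    hr
  refine ⟨(((sphVol n)⁻¹ : ℝ) : ℂ) * D, ?_, ?_⟩
  · rw [funext (sphereRadon_eq_splitLast n f x)]
    exact hD.const_mul _
  · rw [norm_mul, Complex.norm_real, Real.norm_eq_abs, mul_assoc]
    refine mul_le_mul_of_nonneg_left ?_ (abs_nonneg _)
    simpa using hDK

/-- The Poisson-type kernel of `ℝⁿ × ℝ`, written as a rescaled Japanese bracket. -/
theorem integrable_and_integral_poisson (n : ℕ) (x : EuclideanSpace ℝ (Fin n)) {y : ℝ}
    (hy : y ≠ 0) :
    Integrable (fun z : EuclideanSpace ℝ (Fin n) =>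
      (|y| ^ n)⁻¹ * (1 + ‖y⁻¹ • (x - z)‖ ^ 2) ^ (-((n : ℝ) + 1) / 2)) ∧
    ∫ z : EuclideanSpace ℝ (Fin n),
      (|y| ^ n)⁻¹ * (1 + ‖y⁻¹ • (x - z)‖ ^ 2) ^ (-((n : ℝ) + 1) / 2) =
    ∫ z : EuclideanSpace ℝ (Fin n), (1 + ‖z‖ ^ 2) ^ (-((n : ℝ) + 1) / 2) := by
  have h0 : Integrable fun z : EuclideanSpace ℝ (Fin n) =>
      (1 + ‖z‖ ^ 2) ^ (-((n : ℝ) + 1) / 2) :=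
    integrable_rpow_neg_one_add_norm_sq (by simp)
  have h1 := (integrable_comp_smul_iff volume _ (inv_ne_zero hy)).2 h0
  refine ⟨(h1.comp_sub_left x).const_mul _, ?_⟩
  rw [integral_const_mul, integral_sub_left_eq_self (fun z : EuclideanSpace ℝ (Fin n) =>
    (1 + ‖y⁻¹ • z‖ ^ 2) ^ (-((n : ℝ) + 1) / 2)),
    Measure.integral_comp_inv_smul volume (fun z : EuclideanSpace ℝ (Fin n) =>
      (1 + ‖z‖ ^ 2) ^ (-((n : ℝ) + 1) / 2))]
  rw [finrank_euclideanSpace_fin, abs_pow, smul_eq_mul,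
    inv_mul_cancel_left₀ (pow_ne_zero _ (abs_ne_zero.2 hy))]

theorem abs_div_sqrt_pow_eq (n : ℕ) {a y : ℝ} (hy : y ≠ 0) :
    |y| / √(a ^ 2 + y ^ 2) ^ (n + 1) =
      (|y| ^ n)⁻¹ * (1 + (|y⁻¹| * a) ^ 2) ^ (-((n : ℝ) + 1) / 2) := by
  have hy' : 0 < |y| := abs_pos.2 hy
  have h1 : a ^ 2 + y ^ 2 = |y| ^ 2 * (1 + (|y⁻¹| * a) ^ 2) := by
    rw [abs_inv, mul_pow, inv_pow, sq_abs]
    field_simp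
    ring
  have h2 : 0 ≤ 1 + (|y⁻¹| * a) ^ 2 := by positivity
  rw [h1, Real.sqrt_mul (by positivity), Real.sqrt_sq hy'.le, neg_div, Real.rpow_neg h2,
    Real.rpow_div_two_eq_sqrt _ h2, mul_pow]
  norm_cast
  rw [pow_succ |y|]
  field_simp

theorem hasDerivAt_sqrt_sq_add_sq {a y : ℝ} (h : 0 < a ^ 2 + y ^ 2) :
    HasDerivAt (fun t : ℝ => √(a ^ 2 + t ^ 2)) (y / √(a ^ 2 + y ^ 2)) y := by
  have h1 : HasDerivAt (fun t : ℝ => a ^ 2 + t ^ 2) (2 * y) y := by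
    simpa using (hasDerivAt_pow 2 y).const_add (a ^ 2)
  convert h1.sqrt h.ne' using 1
  field_simp

/-- **Well-definedness and boundedness of `R*_∂ g` for `f ∈ 𝒟_e(ℝ^{n+1})`, `g = Rf`.**
The integrand defining `(R*_∂ g)(x,y)` is integrable over ℝⁿ for every `(x,y)`, and
`R*_∂ g` is bounded: there is `C > 0` with `|(R*_∂ g)(x,y)| ≤ C` everywhere. -/
theorem stmt3 (n : ℕ) (hn : 1 ≤ n)
    (f : EuclideanSpace ℝ (Fin n) × ℝ → ℂ)
    (hsmooth : ContDiff ℝ (⊤ : ℕ∞) f) (hsupp : HasCompactSupport f)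
    (heven : ∀ (x : EuclideanSpace ℝ (Fin n)) (y : ℝ), f (x, -y) = f (x, y)) :
    (∀ (x : EuclideanSpace ℝ (Fin n)) (y : ℝ),
        Integrable (fun z : EuclideanSpace ℝ (Fin n) =>
          deriv (fun y' : ℝ => sphereRadon n f z (Real.sqrt (‖x - z‖ ^ 2 + y' ^ 2))) y)) ∧
      ∃ C > 0, ∀ (x : EuclideanSpace ℝ (Fin n)) (y : ℝ),
        ‖RstarPartial n (fun z r => sphereRadon n f z r) x y‖ ≤ C := by
  have hf : ContDiff ℝ 1 f := hsmooth.of_le (by exact_mod_cast le_top)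
  obtain ⟨K, hK0, hK⟩ := exists_hasDerivAt_sphereRadon hf hsupp
  set I : ℝ := ∫ z : EuclideanSpace ℝ (Fin n), (1 + ‖z‖ ^ 2) ^ (-((n : ℝ) + 1) / 2)
  have hmeas : ∀ (x : EuclideanSpace ℝ (Fin n)) (y : ℝ),
      AEStronglyMeasurable (fun z : EuclideanSpace ℝ (Fin n) =>
        deriv (fun y' : ℝ => sphereRadon n f z (Real.sqrt (‖x - z‖ ^ 2 + y' ^ 2))) y) := by
    intro x y
    have hc : Continuous (Function.uncurry fun (z : EuclideanSpace ℝ (Fin n)) (y' : ℝ) =>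
        sphereRadon n f z (Real.sqrt (‖x - z‖ ^ 2 + y' ^ 2))) :=
      (continuous_sphereRadon hf.continuous).comp
        (f := fun q : EuclideanSpace ℝ (Fin n) × ℝ => (q.1, √(‖x - q.1‖ ^ 2 + q.2 ^ 2)))
        (by fun_prop)
    exact ((measurable_deriv_with_param hc).comp
      (measurable_id.prodMk measurable_const)).aestronglyMeasurable
  have hchain : ∀ (x z : EuclideanSpace ℝ (Fin n)) (y : ℝ), 0 < ‖x - z‖ ^ 2 + y ^ 2 →
      ‖deriv (fun y' : ℝ => sphereRadon n f z (Real.sqrt (‖x - z‖ ^ 2 + y' ^ 2))) y‖ ≤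
        K * (|y| / √(‖x - z‖ ^ 2 + y ^ 2) ^ (n + 1)) := by
    intro x z y hpos
    have hr : 0 < √(‖x - z‖ ^ 2 + y ^ 2) := Real.sqrt_pos.2 hpos
    obtain ⟨D, hD, hDK⟩ := hK z _ hr
    have hcomp : HasDerivAt (fun y' : ℝ => sphereRadon n f z (√(‖x - z‖ ^ 2 + y' ^ 2)))
        ((y / √(‖x - z‖ ^ 2 + y ^ 2)) • D) y :=
      HasDerivAt.scomp (h := fun t : ℝ => √(‖x - z‖ ^ 2 + t ^ 2)) y hD
        (hasDerivAt_sqrt_sq_add_sq hpos)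
    rw [hcomp.deriv, norm_smul, norm_div,
      Real.norm_of_nonneg hr.le, Real.norm_eq_abs, ← mul_div_assoc, pow_succ _ n, ← div_div,
      div_mul_eq_mul_div]
    refine div_le_div_of_nonneg_right ?_ hr.le
    rw [le_div_iff₀ (pow_pos hr n)]
    calc |y| * ‖D‖ * √(‖x - z‖ ^ 2 + y ^ 2) ^ n
        = |y| * (‖D‖ * √(‖x - z‖ ^ 2 + y ^ 2) ^ n) := mul_assoc _ _ _
      _ ≤ |y| * K := mul_le_mul_of_nonneg_left hDK (abs_nonneg y)
      _ = K * |y| := mul_comm _ _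
  have hint : ∀ (x : EuclideanSpace ℝ (Fin n)) (y : ℝ),
      Integrable (fun z : EuclideanSpace ℝ (Fin n) =>
        deriv (fun y' : ℝ => sphereRadon n f z (Real.sqrt (‖x - z‖ ^ 2 + y' ^ 2))) y) ∧
      ‖RstarPartial n (fun z r => sphereRadon n f z r) x y‖ ≤ K * I := by
    intro x y
    rcases eq_or_ne y 0 with rfl | hy
    · have : Nonempty (Fin n) := ⟨⟨0, hn⟩⟩
      have hzero : (fun z : EuclideanSpace ℝ (Fin n) =>
          deriv (fun y' : ℝ => sphereRadon n f z (Real.sqrt (‖x - z‖ ^ 2 + y' ^ 2))) 0)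
          =ᵐ[volume] fun _ => 0 := by
        filter_upwards [Measure.ae_ne volume x] with z hz
        have hxz : 0 < ‖x - z‖ := norm_pos_iff.2 (sub_ne_zero.2 hz.symm)
        simpa using hchain x z 0 (by positivity)
      refine ⟨(integrable_zero _ _ _).congr hzero.symm, ?_⟩
      rw [RstarPartial, integral_congr_ae hzero, integral_zero, norm_zero]
      have : 0 ≤ I := integral_nonneg fun z => by positivity
      positivity
    · obtain ⟨hP, hPI⟩ := integrable_and_integral_poisson n x hy
      have hle : ∀ z : EuclideanSpace ℝ (Fin n),
          ‖deriv (fun y' : ℝ => sphereRadon n f z (Real.sqrt (‖x - z‖ ^ 2 + y' ^ 2))) y‖ ≤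
          K * ((|y| ^ n)⁻¹ * (1 + ‖y⁻¹ • (x - z)‖ ^ 2) ^ (-((n : ℝ) + 1) / 2)) := fun z => by
        rw [norm_smul, Real.norm_eq_abs, ← abs_div_sqrt_pow_eq n hy]
        exact hchain x z y (by positivity)
      refine ⟨(hP.const_mul K).mono' (hmeas x y) (.of_forall hle), ?_⟩
      rw [show I = _ from hPI.symm, ← integral_const_mul]
      exact norm_integral_le_of_norm_le (hP.const_mul K) (.of_forall hle)
  refine ⟨fun x y => (hint x y).1, |K * I| + 1, by positivity, fun x y => ?_⟩
  linarith [(hint x y).2, le_abs_self (K * I)]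
end
end

section
/- Let R > 0, b ≥ 0, and ρ > 0 with ρ ≠ b. Then the improper integral lim_{T→∞} ∫_R^T r·J₀(rρ)·cos(b√(r²−R²))/√(r²−R²) dr exists, and it equals cos(R√(ρ²−b²))/√(ρ²−b²) if ρ > b, and 0 if ρ < b. -/
open MeasureTheory Metric Real Filter

noncomputable section

/-- The Bessel function of order zero, `J₀(z) = Σ_{k=0}^∞ (-1)^k z^{2k} / (2^{2k} (k!)²)`. -/
def J0 (z : ℝ) : ℝ :=
  ∑' k : ℕ, (-1 : ℝ) ^ k * z ^ (2 * k) / (2 ^ (2 * k) * ((Nat.factorial k : ℝ)) ^ 2)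

open scoped FourierTransform

theorem tendsto_integral_mul_sin_atTop {g : ℝ → ℝ} (hg : Integrable g) :
    Tendsto (fun S : ℝ => ∫ u, g u * sin (S * u)) atTop (nhds 0) := by
  have h1 : Tendsto (fun S : ℝ => -S / (2 * π)) atTop (cocompact ℝ) := by
    refine Tendsto.mono_right ?_ atBot_le_cocompact
    exact (tendsto_neg_atTop_atBot).atBot_div_const (by positivity)
  have h2 := (Complex.continuous_im.tendsto 0).comp
    ((Real.tendsto_integral_exp_smul_cocompact (fun u => (g u : ℂ))).comp h1)
  refine h2.congr fun S => ?_
  have hi : Integrable (fun u : ℝ => 𝐞 (-(u * (-S / (2 * π)))) • (g u : ℂ)) :=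
    (Real.fourierIntegral_convergent_iff (μ := volume) (f := fun u => (g u : ℂ)) (-S / (2 * π))).2
      hg.ofReal |>.congr (by simp [mul_comm])
  have := (Complex.imCLM.integral_comp_comm hi).symm
  simp only [Function.comp_apply]
  refine this.trans (integral_congr_ae (.of_forall fun u => ?_))
  have e : (2 * π * -(u * (-S / (2 * π)))) = S * u := by field_simp
  simp only [Complex.imCLM_apply, Circle.smul_def, Real.fourierChar_apply, smul_eq_mul,
    Complex.im_mul_ofReal, e, Complex.exp_ofReal_mul_I_im]
  ring

theorem integral_mul_self_mul_cos (c u S : ℝ) :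
    ∫ s in (0 : ℝ)..S, u * c * cos (s * u) = c * sin (S * u) := by
  have h : ∀ s ∈ Set.uIcc 0 S, HasDerivAt (fun s => c * sin (s * u)) (u * c * cos (s * u)) s := by
    intro s _
    refine ((((hasDerivAt_id' s).mul_const u).sin).const_mul c).congr_deriv ?_
    ring
  rw [intervalIntegral.integral_eq_sub_of_hasDerivAt h (by
    apply Continuous.intervalIntegrable; fun_prop)]
  simp

theorem integrable_mul_cos_prod {G : ℝ → ℝ} (hG : Integrable G) (S : ℝ) :
    Integrable (Function.uncurry fun s u : ℝ => G u * cos (s * u))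
      ((volume.restrict (Set.uIoc 0 S)).prod volume) := by
  have : IsFiniteMeasure (volume.restrict (Set.uIoc 0 S)) :=
    isFiniteMeasure_restrict.2 (by simp [Set.uIoc])
  have h : Integrable (fun p : ℝ × ℝ => (1 : ℝ) * G p.2)
      ((volume.restrict (Set.uIoc 0 S)).prod volume) :=
    Integrable.mul_prod (integrable_const 1) hG
  simp only [one_mul] at h
  refine h.mul_bdd (c := 1) (by fun_prop) (.of_forall fun p => ?_)
  simpa using abs_cos_le_one _

theorem integral_integral_mul_cos {g : ℝ → ℝ} (hg : Integrable fun u => u * g u) (S : ℝ) :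
    ∫ s in (0 : ℝ)..S, ∫ u, u * g u * cos (s * u) = ∫ u, g u * sin (S * u) := by
  rw [intervalIntegral_integral_swap (integrable_mul_cos_prod hg S)]
  simp only [integral_mul_self_mul_cos]

theorem intervalIntegrable_integral_mul_cos {G : ℝ → ℝ} (hG : Integrable G) (S : ℝ) :
    IntervalIntegrable (fun s => ∫ u, G u * cos (s * u)) volume 0 S :=
  intervalIntegrable_iff.2 (integrable_mul_cos_prod hG S).integral_prod_left

theorem integrable_div_self {G : ℝ → ℝ} {G' : ℝ} (hG : Integrable G) (h0 : G 0 = 0)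
    (hd : HasDerivAt G G' 0) : Integrable fun u => G u / u := by
  obtain ⟨C, hC⟩ := hd.isBigO_sub.bound
  obtain ⟨δ, hδ, hball⟩ := Metric.eventually_nhds_iff.1 hC
  have hi : Integrable ((Set.Icc (-δ) δ).indicator fun _ : ℝ => |C|) :=
    (integrable_indicator_iff measurableSet_Icc).2 (by simp)
  refine (hi.add (hG.norm.div_const δ)).mono'
    (hG.aestronglyMeasurable.div₀ (by fun_prop)) (.of_forall fun u => ?_)
  simp only [Pi.add_apply, norm_div, Real.norm_eq_abs]
  by_cases hu : |u| < δ
  · rw [Set.indicator_of_mem (Set.mem_Icc.2 (abs_le.1 hu.le))]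
    have hb : |G u| ≤ C * |u| := by simpa [h0] using hball (y := u) (by simpa using hu)
    have hp : 0 ≤ |G u| / δ := by positivity
    have : |G u| / |u| ≤ |C| := by
      rcases eq_or_ne u 0 with rfl | hne
      · simp
      · rw [div_le_iff₀ (abs_pos.2 hne)]
        exact hb.trans (by gcongr; exact le_abs_self C)
    linarith
  · have h1 : |G u| / |u| ≤ |G u| / δ := by gcongr; exact not_lt.1 hu
    have h2 : 0 ≤ (Set.Icc (-δ) δ).indicator (fun _ : ℝ => |C|) u :=
      Set.indicator_nonneg (fun _ _ => abs_nonneg _) _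
    linarith

theorem integral_exp_neg_sq_mul_cos (s : ℝ) :
    ∫ u : ℝ, exp (-u ^ 2) * cos (s * u) = √π * exp (-(1 / 4) * s ^ 2) := by
  have h := congrArg Complex.re (fourierIntegral_gaussian (b := 1) (by simp) (s : ℂ))
  have hi : Integrable fun u : ℝ => Complex.exp (Complex.I * s * u) * Complex.exp (-1 * u ^ 2) := by
    have := integrable_exp_neg_mul_sq (b := 1) one_pos
    refine ((this.ofReal (𝕜 := ℂ)).bdd_mul (c := 1)
      (f := fun u : ℝ => Complex.exp (Complex.I * s * u)) (by fun_prop)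
      (.of_forall fun u => ?_)).congr (.of_forall fun u => by simp)
    rw [mul_assoc, ← Complex.ofReal_mul, mul_comm, Complex.norm_exp_ofReal_mul_I]
  have h' := (Complex.reCLM.integral_comp_comm hi)
  rw [Complex.reCLM_apply, h] at h'
  have e : ((π : ℂ) / 1) ^ (1 / 2 : ℂ) * Complex.exp (-(s : ℂ) ^ 2 / (4 * 1)) =
      ((√π * exp (-(1 / 4) * s ^ 2) : ℝ) : ℂ) := by
    rw [Real.sqrt_eq_rpow, Complex.ofReal_mul, Complex.ofReal_cpow pi_pos.le]
    push_cast
    congr 2 <;> ring_nf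
  rw [e, Complex.ofReal_re] at h'
  rw [← h']
  refine integral_congr_ae (.of_forall fun u => ?_)
  have e1 : Complex.I * s * u = ((s * u : ℝ) : ℂ) * Complex.I := by push_cast; ring
  have e2 : Complex.exp (-1 * (u : ℂ) ^ 2) = ((exp (-u ^ 2) : ℝ) : ℂ) := by push_cast; ring_nf
  simp only [Complex.reCLM_apply]
  rw [e1, e2, Complex.re_mul_ofReal, Complex.exp_ofReal_mul_I_re, mul_comm]

theorem tendsto_integral_integral_exp_neg_sq_mul_cos :
    Tendsto (fun S : ℝ => ∫ s in (0 : ℝ)..S, ∫ u : ℝ, exp (-u ^ 2) * cos (s * u))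
      atTop (nhds π) := by
  simp only [integral_exp_neg_sq_mul_cos, intervalIntegral.integral_const_mul]
  have h := (intervalIntegral_tendsto_integral_Ioi (0 : ℝ)
    (integrable_exp_neg_mul_sq (b := 1 / 4) (by norm_num)).integrableOn tendsto_id).const_mul √π
  rw [integral_gaussian_Ioi] at h
  suffices π = √π * (√(π / (1 / 4)) / 2) by rwa [← this] at h
  have : π / (1 / 4) = π * 2 ^ 2 := by ring
  rw [this, Real.sqrt_mul pi_pos.le, Real.sqrt_sq two_pos.le]
  have := Real.mul_self_sqrt pi_pos.le
  linarith

/-- Dini's criterion for the convergence of the Fourier integral at a point of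
differentiability. -/
theorem tendsto_integral_integral_mul_cos {F : ℝ → ℝ} {F' : ℝ} (hF : Integrable F)
    (hd : HasDerivAt F F' 0) :
    Tendsto (fun S : ℝ => ∫ s in (0 : ℝ)..S, ∫ u, F u * cos (s * u)) atTop (nhds (π * F 0)) := by
  have hE : Integrable fun u : ℝ => exp (-u ^ 2) := by
    simpa using integrable_exp_neg_mul_sq (b := 1) one_pos
  set G : ℝ → ℝ := fun u => F u - F 0 * exp (-u ^ 2) with hGdef
  have hG : Integrable G := hF.sub (hE.const_mul _)
  have h0 : G 0 = 0 := by simp [hGdef]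
  have hGd : DifferentiableAt ℝ G 0 := hd.differentiableAt.sub (by fun_prop)
  have hself : (fun u => u * (G u / u)) = G := by
    ext u
    rcases eq_or_ne u 0 with rfl | hu
    · simp [h0]
    · field_simp
  have hlim := tendsto_integral_mul_sin_atTop (integrable_div_self hG h0 hGd.hasDerivAt)
  have hsum := hlim.add (tendsto_integral_integral_exp_neg_sq_mul_cos.const_mul (F 0))
  rw [zero_add, mul_comm] at hsum
  refine hsum.congr fun S => ?_
  rw [← integral_integral_mul_cos (by rwa [hself]), ← intervalIntegral.integral_const_mul,
    ← intervalIntegral.integral_add]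
  · refine intervalIntegral.integral_congr fun s _ => ?_
    have hc : ∀ {H : ℝ → ℝ}, Integrable H → Integrable fun u => H u * cos (s * u) := fun hH =>
      hH.mul_bdd (c := 1) (by fun_prop) (.of_forall fun u => by simpa using abs_cos_le_one _)
    simp only [← integral_const_mul]
    rw [← integral_add (hc (by rwa [hself])) ((hc hE).const_mul _)]
    refine integral_congr_ae (.of_forall fun u => ?_)
    have := congrFun hself u
    beta_reduce at this ⊢
    rw [this]
    ring
  · exact intervalIntegrable_integral_mul_cos (by rwa [hself]) S
  · exact (intervalIntegrable_integral_mul_cos hE S).const_mul _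

theorem prod_odd_div_even_eq (k : ℕ) :
    ∏ i ∈ Finset.range k, (2 * (i : ℝ) + 1) / (2 * i + 2) =
      (2 * k).factorial / (2 ^ (2 * k) * (k.factorial : ℝ) ^ 2) := by
  induction k with
  | zero => simp
  | succ k ih =>
    rw [Finset.prod_range_succ, ih, show 2 * (k + 1) = 2 * k + 1 + 1 by ring,
      Nat.factorial_succ, Nat.factorial_succ, Nat.factorial_succ]
    push_cast
    field_simp
    ring

/-- Bessel's integral representation of `J0`. -/
theorem J0_eq_integral (z : ℝ) : J0 z = π⁻¹ * ∫ θ in (0 : ℝ)..π, cos (z * sin θ) := by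
  have h := intervalIntegral.hasSum_integral_of_dominated_convergence (μ := volume)
    (a := 0) (b := π) (f := fun θ => cos (z * sin θ))
    (F := fun (k : ℕ) θ => (-1 : ℝ) ^ k * (z * sin θ) ^ (2 * k) / (2 * k).factorial)
    (fun k _ => |z| ^ (2 * k) / (2 * k).factorial)
    (fun k => by fun_prop)
    (fun k => .of_forall fun θ _ => by
      rw [norm_div, norm_mul, norm_pow, norm_pow, norm_mul]
      simp only [norm_neg, norm_one, one_pow, one_mul, Real.norm_eq_abs, Nat.abs_cast]
      gcongr
      exact mul_le_of_le_one_right (abs_nonneg _) (abs_sin_le_one _))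
    (.of_forall fun θ _ => (Real.summable_pow_div_factorial |z|).comp_injective
      (mul_right_injective₀ two_ne_zero))
    (by simp)
    (.of_forall fun θ _ => Real.hasSum_cos _)
  rw [← h.tsum_eq, ← tsum_mul_left, J0]
  refine tsum_congr fun k => ?_
  have e : ∀ θ : ℝ, (-1 : ℝ) ^ k * (z * sin θ) ^ (2 * k) / (2 * k).factorial =
      (-1 : ℝ) ^ k * z ^ (2 * k) / (2 * k).factorial * sin θ ^ (2 * k) := fun θ => by
    rw [mul_pow]
    ring
  simp only [e, intervalIntegral.integral_const_mul, integral_sin_pow_even, prod_odd_div_even_eq]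
  have := pi_ne_zero
  field_simp

theorem J0_sqrt_sq_add_sq (x y : ℝ) :
    J0 √(x ^ 2 + y ^ 2) = π⁻¹ * ∫ θ in (-(π / 2))..(π / 2), cos (x * sin θ + y * cos θ) := by
  obtain ⟨r, φ, hr, hx, hy⟩ : ∃ r φ : ℝ, 0 ≤ r ∧ x = r * cos φ ∧ y = r * sin φ :=
    ⟨‖(⟨x, y⟩ : ℂ)‖, Complex.arg ⟨x, y⟩, norm_nonneg _, by simp, by simp⟩
  have h1 : √(x ^ 2 + y ^ 2) = r := by
    rw [hx, hy, show (r * cos φ) ^ 2 + (r * sin φ) ^ 2 = r ^ 2 * (sin φ ^ 2 + cos φ ^ 2) by ring,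
      sin_sq_add_cos_sq, mul_one, sqrt_sq hr]
  have hper : Function.Periodic (fun θ => cos (r * sin θ)) π := fun θ => by
    simp [sin_add_pi]
  rw [h1, J0_eq_integral]
  congr 1
  calc ∫ θ in (0 : ℝ)..π, cos (r * sin θ)
      = ∫ θ in (-(π / 2) + φ)..(π / 2 + φ), cos (r * sin θ) := by
        have := hper.intervalIntegral_add_eq 0 (-(π / 2) + φ)
        rwa [zero_add, show -(π / 2) + φ + π = π / 2 + φ by ring] at this
    _ = ∫ θ in (-(π / 2))..(π / 2), cos (r * sin (θ + φ)) := by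
        rw [intervalIntegral.integral_comp_add_right fun θ => cos (r * sin θ)]
    _ = ∫ θ in (-(π / 2))..(π / 2), cos (x * sin θ + y * cos θ) := by
        refine intervalIntegral.integral_congr fun θ _ => ?_
        simp only [hx, hy, sin_add]
        ring_nf

theorem intervalIntegral_eq_zero_of_odd {f : ℝ → ℝ} (hf : ∀ x, f (-x) = -f x) (a : ℝ) :
    ∫ x in (-a)..a, f x = 0 := by
  have h := intervalIntegral.integral_comp_neg (a := -a) (b := a) f
  simp only [hf, intervalIntegral.integral_neg, neg_neg] at h
  linarith

theorem J0_mul_cos_eq_integral {ρ : ℝ} (hρ : 0 < ρ) (R b s : ℝ) :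
    π * (J0 (√(s ^ 2 + R ^ 2) * ρ) * cos (b * s)) =
      ∫ θ in (-(π / 2))..(π / 2), cos (R * (ρ * cos θ)) * cos (s * (ρ * sin θ - b)) := by
  have e : √(s ^ 2 + R ^ 2) * ρ = √((s * ρ) ^ 2 + (R * ρ) ^ 2) := by
    rw [show (s * ρ) ^ 2 + (R * ρ) ^ 2 = (s ^ 2 + R ^ 2) * ρ ^ 2 by ring,
      sqrt_mul (by positivity), sqrt_sq hρ.le]
  rw [e, J0_sqrt_sq_add_sq, mul_comm (π⁻¹ * _), mul_left_comm, mul_inv_cancel_left₀ pi_ne_zero,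
    ← intervalIntegral.integral_const_mul, ← sub_eq_zero, ← intervalIntegral.integral_sub
      (Continuous.intervalIntegrable (by fun_prop) _ _)
      (Continuous.intervalIntegrable (by fun_prop) _ _)]
  refine intervalIntegral_eq_zero_of_odd (fun θ => ?_) _
  rw [show s * (ρ * sin (-θ) - b) = -(s * ρ * sin θ) - b * s by rw [sin_neg]; ring,
    show s * (ρ * sin θ - b) = s * ρ * sin θ - b * s by ring, sin_neg, cos_neg, mul_neg,
    ← mul_assoc R]
  simp only [cos_add, cos_sub, sin_neg, cos_neg]
  ring

theorem image_mul_sin_sub {ρ : ℝ} (hρ : 0 < ρ) (b : ℝ) :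
    (fun θ => ρ * sin θ - b) '' Set.Ioo (-(π / 2)) (π / 2) = Set.Ioo (-ρ - b) (ρ - b) := by
  ext u
  simp only [Set.mem_image, Set.mem_Ioo]
  constructor
  · rintro ⟨θ, ⟨h1, h2⟩, rfl⟩
    have hcos := cos_pos_of_mem_Ioo ⟨h1, h2⟩
    have := sin_sq_add_cos_sq θ
    have hs : |sin θ| < 1 := (sq_lt_one_iff_abs_lt_one _).1 (by nlinarith)
    have := abs_lt.1 hs
    constructor <;> nlinarith
  · rintro ⟨h1, h2⟩
    have h3 : -1 < (u + b) / ρ := by rw [lt_div_iff₀ hρ]; linarith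
    have h4 : (u + b) / ρ < 1 := by rw [div_lt_iff₀ hρ]; linarith
    refine ⟨arcsin ((u + b) / ρ), ⟨neg_pi_div_two_lt_arcsin.2 h3, arcsin_lt_pi_div_two.2 h4⟩, ?_⟩
    rw [sin_arcsin h3.le h4.le]
    field_simp
    ring

/-- The cosine transform of `s ↦ J0 (ρ √(s² + R²))`, translated by `b`. -/
def J0Spectrum (R b ρ : ℝ) : ℝ → ℝ :=
  (Set.Ioo (-ρ - b) (ρ - b)).indicator fun u =>
    cos (R * √(ρ ^ 2 - (u + b) ^ 2)) / √(ρ ^ 2 - (u + b) ^ 2)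

theorem sqrt_sq_sub_mul_sin_sq {ρ : ℝ} (hρ : 0 < ρ) (b : ℝ) {θ : ℝ}
    (hθ : θ ∈ Set.Ioo (-(π / 2)) (π / 2)) :
    √(ρ ^ 2 - (ρ * sin θ - b + b) ^ 2) = ρ * cos θ := by
  have hc := cos_pos_of_mem_Ioo hθ
  rw [sqrt_eq_iff_mul_self_eq_of_pos (by positivity)]
  linear_combination ρ ^ 2 * sin_sq_add_cos_sq θ

theorem abs_deriv_smul_kernel {ρ : ℝ} (hρ : 0 < ρ) (R b : ℝ) {θ : ℝ}
    (hθ : θ ∈ Set.Ioo (-(π / 2)) (π / 2)) (c : ℝ) :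
    |ρ * cos θ| • (cos (R * √(ρ ^ 2 - (ρ * sin θ - b + b) ^ 2)) /
      √(ρ ^ 2 - (ρ * sin θ - b + b) ^ 2) * c) = cos (R * (ρ * cos θ)) * c := by
  have hc := cos_pos_of_mem_Ioo hθ
  rw [sqrt_sq_sub_mul_sin_sq hρ b hθ, abs_of_pos (by positivity), smul_eq_mul]
  field_simp

theorem hasDerivWithinAt_mul_sin_sub (ρ b θ : ℝ) (t : Set ℝ) :
    HasDerivWithinAt (fun θ => ρ * sin θ - b) (ρ * cos θ) t θ :=
  (((hasDerivAt_sin θ).const_mul ρ).sub_const b).hasDerivWithinAt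

theorem injOn_mul_sin_sub {ρ : ℝ} (hρ : 0 < ρ) (b : ℝ) :
    Set.InjOn (fun θ => ρ * sin θ - b) (Set.Ioo (-(π / 2)) (π / 2)) := by
  intro x hx y hy h
  exact injOn_sin (Set.Ioo_subset_Icc_self hx) (Set.Ioo_subset_Icc_self hy)
    (mul_left_cancel₀ hρ.ne' (sub_left_injective h))

theorem integrable_J0Spectrum {ρ : ℝ} (hρ : 0 < ρ) (R b : ℝ) :
    Integrable (J0Spectrum R b ρ) := by
  rw [J0Spectrum, integrable_indicator_iff measurableSet_Ioo, ← image_mul_sin_sub hρ,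
    integrableOn_image_iff_integrableOn_abs_deriv_smul measurableSet_Ioo
      (fun θ _ => hasDerivWithinAt_mul_sin_sub ρ b θ _) (injOn_mul_sin_sub hρ b)]
  have hcont : Continuous fun θ => cos (R * (ρ * cos θ)) := by fun_prop
  refine ((hcont.integrableOn_Icc (a := -(π / 2)) (b := π / 2)).mono_set
    Set.Ioo_subset_Icc_self).congr_fun (fun θ hθ => ?_) measurableSet_Ioo
  simpa using (abs_deriv_smul_kernel hρ R b hθ 1).symm

theorem integral_J0Spectrum_mul_cos {ρ : ℝ} (hρ : 0 < ρ) (R b s : ℝ) :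
    ∫ u, J0Spectrum R b ρ u * cos (s * u) = π * (J0 (√(s ^ 2 + R ^ 2) * ρ) * cos (b * s)) := by
  rw [J0_mul_cos_eq_integral hρ, intervalIntegral.integral_of_le (by linarith [pi_pos]),
    integral_Ioc_eq_integral_Ioo]
  have e : (fun u => J0Spectrum R b ρ u * cos (s * u)) =
      (Set.Ioo (-ρ - b) (ρ - b)).indicator fun u =>
        cos (R * √(ρ ^ 2 - (u + b) ^ 2)) / √(ρ ^ 2 - (u + b) ^ 2) * cos (s * u) :=
    funext fun u => (Set.indicator_mul_left _ _ fun u => cos (s * u)).symm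
  rw [e, integral_indicator measurableSet_Ioo, ← image_mul_sin_sub hρ,
    integral_image_eq_integral_abs_deriv_smul measurableSet_Ioo
      (fun θ _ => hasDerivWithinAt_mul_sin_sub ρ b θ _) (injOn_mul_sin_sub hρ b)]
  exact setIntegral_congr_fun measurableSet_Ioo fun θ hθ => abs_deriv_smul_kernel hρ R b hθ _

theorem J0Spectrum_zero {R b ρ : ℝ} (hb : 0 ≤ b) (hρ : 0 < ρ) :
    J0Spectrum R b ρ 0 =
      if b < ρ then cos (R * √(ρ ^ 2 - b ^ 2)) / √(ρ ^ 2 - b ^ 2) else 0 := by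
  have : (0 : ℝ) ∈ Set.Ioo (-ρ - b) (ρ - b) ↔ b < ρ := by
    rw [Set.mem_Ioo]
    constructor
    · rintro ⟨-, h⟩; linarith
    · intro h; constructor <;> linarith
  simp only [J0Spectrum, Set.indicator_apply, this, zero_add]

theorem differentiableAt_J0Spectrum_zero {R b ρ : ℝ} (hb : 0 ≤ b) (hρ : 0 < ρ) (hne : ρ ≠ b) :
    DifferentiableAt ℝ (J0Spectrum R b ρ) 0 := by
  rcases lt_or_gt_of_ne hne with h | h
  · refine (differentiableAt_const (0 : ℝ)).congr_of_eventuallyEq ?_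
    filter_upwards [lt_mem_nhds (show ρ - b < 0 by linarith)] with u hu
    exact Set.indicator_of_notMem (fun hm => hm.2.not_gt hu) _
  · have hpos : ρ ^ 2 - (0 + b) ^ 2 ≠ 0 := by nlinarith
    have hd : DifferentiableAt ℝ (fun u => √(ρ ^ 2 - (u + b) ^ 2)) 0 :=
      DifferentiableAt.sqrt (by fun_prop) hpos
    have hs : √(ρ ^ 2 - (0 + b) ^ 2) ≠ 0 := (sqrt_pos.2 (by nlinarith)).ne'
    have hd' := ((hd.const_mul R).cos).div hd hs
    refine hd'.congr_of_eventuallyEq ?_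
    filter_upwards [Ioo_mem_nhds (show -ρ - b < 0 by linarith) (show 0 < ρ - b by linarith)]
      with u hu
    exact Set.indicator_of_mem hu _

theorem tendsto_integral_J0_mul_cos {R b ρ : ℝ} (hb : 0 ≤ b) (hρ : 0 < ρ) (hne : ρ ≠ b) :
    Tendsto (fun S : ℝ => ∫ s in (0 : ℝ)..S, J0 (√(s ^ 2 + R ^ 2) * ρ) * cos (b * s)) atTop
      (nhds (J0Spectrum R b ρ 0)) := by
  have h := (tendsto_integral_integral_mul_cos (integrable_J0Spectrum hρ R b)
    (differentiableAt_J0Spectrum_zero hb hρ hne).hasDerivAt).const_mul π⁻¹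
  simpa only [integral_J0Spectrum_mul_cos hρ, intervalIntegral.integral_const_mul,
    inv_mul_cancel_left₀ pi_ne_zero] using h

theorem image_sqrt_sq_add_sq {R T : ℝ} (hR : 0 < R) (hT : R ≤ T) :
    (fun s => √(s ^ 2 + R ^ 2)) '' Set.Ioo 0 √(T ^ 2 - R ^ 2) = Set.Ioo R T := by
  ext r
  simp only [Set.mem_image, Set.mem_Ioo]
  constructor
  · rintro ⟨s, ⟨h1, h2⟩, rfl⟩
    have h3 := (lt_sqrt h1.le).1 h2
    exact ⟨lt_sqrt_of_sq_lt (by nlinarith), (sqrt_lt' (by linarith)).2 (by linarith)⟩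
  · rintro ⟨h1, h2⟩
    refine ⟨√(r ^ 2 - R ^ 2), ⟨sqrt_pos.2 (by nlinarith),
      sqrt_lt_sqrt (by nlinarith) (by nlinarith)⟩, ?_⟩
    rw [sq_sqrt (by nlinarith), sub_add_cancel, sqrt_sq (by linarith)]

theorem integral_eq_integral_comp_sqrt {R T : ℝ} (hR : 0 < R) (hT : R ≤ T) (g : ℝ → ℝ)
    (h : ℝ → ℝ) :
    ∫ r in R..T, r * g r * h √(r ^ 2 - R ^ 2) / √(r ^ 2 - R ^ 2) =
      ∫ s in (0 : ℝ)..√(T ^ 2 - R ^ 2), g √(s ^ 2 + R ^ 2) * h s := by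
  have hpos : ∀ s : ℝ, 0 < s ^ 2 + R ^ 2 := fun s => by positivity
  have hd : ∀ s ∈ Set.Ioo 0 √(T ^ 2 - R ^ 2), HasDerivWithinAt (fun s => √(s ^ 2 + R ^ 2))
      (s / √(s ^ 2 + R ^ 2)) (Set.Ioo 0 √(T ^ 2 - R ^ 2)) s := fun s _ => by
    refine ((((hasDerivAt_pow 2 s).add_const (R ^ 2)).sqrt
      (hpos s).ne').congr_deriv ?_).hasDerivWithinAt
    field_simp
    simp
  have hinj : Set.InjOn (fun s => √(s ^ 2 + R ^ 2)) (Set.Ioo 0 √(T ^ 2 - R ^ 2)) := by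
    intro x hx y hy hxy
    have := (sqrt_inj (hpos x).le (hpos y).le).1 hxy
    exact (sq_eq_sq₀ hx.1.le hy.1.le).1 (by linarith)
  rw [intervalIntegral.integral_of_le hT, intervalIntegral.integral_of_le (sqrt_nonneg _),
    integral_Ioc_eq_integral_Ioo, integral_Ioc_eq_integral_Ioo, ← image_sqrt_sq_add_sq hR hT,
    integral_image_eq_integral_abs_deriv_smul measurableSet_Ioo hd hinj]
  refine setIntegral_congr_fun measurableSet_Ioo fun s hs => ?_
  have hs0 := hs.1
  have hq := sqrt_pos.2 (hpos s)
  have e : √(√(s ^ 2 + R ^ 2) ^ 2 - R ^ 2) = s := by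
    rw [sq_sqrt (hpos s).le, add_sub_cancel_right, sqrt_sq hs0.le]
  simp only [e, smul_eq_mul]
  rw [abs_of_pos (by positivity)]
  field_simp

/-- **Hankel transform of the truncated kernel (Oberhettinger).**
For `R > 0`, `b ≥ 0`, `ρ > 0`, `ρ ≠ b`, the improper integral
`lim_{T→∞} ∫_R^T r·J₀(rρ)·cos(b√(r²-R²))/√(r²-R²) dr` exists and equals
`cos(R√(ρ²-b²))/√(ρ²-b²)` if `ρ > b`, and `0` if `ρ < b`. -/
theorem stmt8 (R b ρ : ℝ) (hR : 0 < R) (hb : 0 ≤ b) (hρ : 0 < ρ) (hne : ρ ≠ b) :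
    Filter.Tendsto
      (fun T : ℝ => ∫ r in R..T,
        r * J0 (r * ρ) * Real.cos (b * Real.sqrt (r ^ 2 - R ^ 2)) /
          Real.sqrt (r ^ 2 - R ^ 2))
      Filter.atTop
      (nhds (if b < ρ then
          Real.cos (R * Real.sqrt (ρ ^ 2 - b ^ 2)) / Real.sqrt (ρ ^ 2 - b ^ 2)
        else 0)) := by
  rw [← J0Spectrum_zero hb hρ]
  have hS : Tendsto (fun T : ℝ => √(T ^ 2 - R ^ 2)) atTop atTop :=
    tendsto_sqrt_atTop.comp
      (tendsto_atTop_add_const_right _ (-R ^ 2) (tendsto_pow_atTop two_ne_zero))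
  refine ((tendsto_integral_J0_mul_cos (R := R) hb hρ hne).comp hS).congr' ?_
  filter_upwards [eventually_ge_atTop R] with T hT
  exact (integral_eq_integral_comp_sqrt hR hT (fun r => J0 (r * ρ)) fun s => cos (b * s)).symm
end
end

section
/- Let R > 0, b ≥ 0, and ρ ≥ 0 with ρ² + b² > 0. Then ∫_0^R r·J₀(rρ)·cos(b√(R²−r²))/√(R²−r²) dr = sin(R√(ρ²+b²))/√(ρ²+b²). -/
open MeasureTheory Metric Real Filter

noncomputable section

/-- The series defining `J0` converges; it is written here in terms of `x` with `z ^ 2 = x`. -/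
lemma hasSum_J0 {z x : ℝ} (hzx : z ^ 2 = x) :
    HasSum (fun k : ℕ => (-1 : ℝ) ^ k * x ^ k / (4 ^ k * (Nat.factorial k : ℝ) ^ 2)) (J0 z) := by
  subst hzx
  have hs : Summable
      (fun k : ℕ => (-1 : ℝ) ^ k * (z ^ 2) ^ k / (4 ^ k * (Nat.factorial k : ℝ) ^ 2)) := by
    refine Summable.of_norm_bounded (Real.summable_pow_div_factorial (z ^ 2)) fun k => ?_
    have h4 : (1 : ℝ) ≤ 4 ^ k := one_le_pow₀ (by norm_num)
    have hk : (1 : ℝ) ≤ Nat.factorial k := by exact_mod_cast Nat.factorial_pos k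
    rw [norm_div, norm_mul, norm_pow, norm_neg, norm_one, one_pow, one_mul,
      Real.norm_of_nonneg (by positivity), Real.norm_of_nonneg (by positivity)]
    gcongr
    nlinarith
  have hJ : J0 z =
      ∑' k : ℕ, (-1 : ℝ) ^ k * (z ^ 2) ^ k / (4 ^ k * (Nat.factorial k : ℝ) ^ 2) := by
    refine tsum_congr fun k => ?_
    rw [pow_mul, pow_mul]
    norm_num
  rw [hJ]
  exact hs.hasSum

/-- A Beta integral over `[0, R]` with half-integer parameter. -/
lemma integral_sq_sub_sq_pow_mul_pow (R : ℝ) (k m : ℕ) :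
    ∫ s in (0 : ℝ)..R, (R ^ 2 - s ^ 2) ^ k * s ^ (2 * m) =
      R ^ (2 * (k + m) + 1) * (4 ^ k * Nat.factorial k * Nat.factorial (2 * m) *
        Nat.factorial (k + m)) / (Nat.factorial m * Nat.factorial (2 * (k + m) + 1)) := by
  induction k generalizing m with
  | zero =>
    have h1 : (Nat.factorial m : ℝ) ≠ 0 := by positivity
    have h2 : (Nat.factorial (2 * m) : ℝ) ≠ 0 := by positivity
    have h3 : (2 * m + 1 : ℝ) ≠ 0 := by positivity
    simp only [pow_zero, one_mul, integral_pow, zero_add, Nat.factorial_zero, Nat.cast_one,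
      Nat.factorial_succ (2 * m)]
    push_cast
    field_simp
    simp
  | succ k ih =>
    have hd : ∀ s ∈ Set.uIcc 0 R, HasDerivAt
        (fun s : ℝ => (R ^ 2 - s ^ 2) ^ (k + 1) * s ^ (2 * m + 1))
        ((2 * m + 1) * ((R ^ 2 - s ^ 2) ^ (k + 1) * s ^ (2 * m)) -
          2 * (k + 1) * ((R ^ 2 - s ^ 2) ^ k * s ^ (2 * (m + 1)))) s := by
      intro s _
      have := ((((hasDerivAt_id s).pow 2).const_sub (R ^ 2)).pow (k + 1)).mul
        ((hasDerivAt_id s).pow (2 * m + 1))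
      refine this.congr_deriv ?_
      simp
      ring
    have hftc := intervalIntegral.integral_eq_sub_of_hasDerivAt hd
      ((by fun_prop : Continuous _).intervalIntegrable _ _)
    rw [intervalIntegral.integral_sub ((by fun_prop : Continuous _).intervalIntegrable _ _)
      ((by fun_prop : Continuous _).intervalIntegrable _ _),
      intervalIntegral.integral_const_mul, intervalIntegral.integral_const_mul, ih (m + 1)] at hftc
    have h3 : (2 * m + 1 : ℝ) ≠ 0 := by positivity
    simp only [sub_self, zero_pow (Nat.succ_ne_zero _), zero_mul, mul_zero] at hftc
    rw [sub_eq_zero] at hftc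
    refine mul_left_cancel₀ h3 (hftc.trans ?_)
    have e : k + (m + 1) = k + 1 + m := by ring
    have e2 : 2 * (m + 1) = 2 * m + 1 + 1 := by ring
    have h1 : (Nat.factorial m : ℝ) ≠ 0 := by positivity
    have h2 : (Nat.factorial (2 * (k + 1 + m) + 1) : ℝ) ≠ 0 := by positivity
    rw [e, e2, Nat.factorial_succ (2 * m + 1), Nat.factorial_succ (2 * m), Nat.factorial_succ m,
      Nat.factorial_succ k]
    push_cast
    field_simp
    ring

/-- The substitution `s = √(R² - r²)` on `(0, R)`. -/
lemma integral_comp_sqrt_sq_sub_sq {R : ℝ} (hR : 0 < R) (g : ℝ → ℝ) :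
    ∫ r in (0 : ℝ)..R, r / √(R ^ 2 - r ^ 2) * g (√(R ^ 2 - r ^ 2)) =
      ∫ s in (0 : ℝ)..R, g s := by
  have hpos : ∀ r ∈ Set.Ioo 0 R, 0 < R ^ 2 - r ^ 2 := fun r hr => by
    nlinarith [hr.1, hr.2]
  have hinv : ∀ r ∈ Set.Ioo 0 R, √(R ^ 2 - √(R ^ 2 - r ^ 2) ^ 2) = r := fun r hr => by
    rw [Real.sq_sqrt (hpos r hr).le, sub_sub_cancel, Real.sqrt_sq hr.1.le]
  have hmaps : Set.MapsTo (fun r : ℝ => √(R ^ 2 - r ^ 2)) (Set.Ioo 0 R) (Set.Ioo 0 R) := by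
    intro r hr
    refine ⟨Real.sqrt_pos.2 (hpos r hr), (Real.sqrt_lt' hR).2 ?_⟩
    nlinarith [hr.1]
  have himage : (fun r : ℝ => √(R ^ 2 - r ^ 2)) '' Set.Ioo 0 R = Set.Ioo 0 R :=
    hmaps.image_subset.antisymm fun r hr => ⟨_, hmaps hr, hinv r hr⟩
  have hderiv : ∀ r ∈ Set.Ioo 0 R, HasDerivWithinAt (fun r : ℝ => √(R ^ 2 - r ^ 2))
      (-(r / √(R ^ 2 - r ^ 2))) (Set.Ioo 0 R) r := by
    intro r hr
    have := (((hasDerivAt_id r).pow 2).const_sub (R ^ 2)).sqrt (hpos r hr).ne'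
    refine (this.congr_deriv ?_).hasDerivWithinAt
    have := (Real.sqrt_pos.2 (hpos r hr)).ne'
    simp
    field_simp
  have hcov := integral_image_eq_integral_abs_deriv_smul measurableSet_Ioo hderiv
    (Set.LeftInvOn.injOn (f₁' := fun r : ℝ => √(R ^ 2 - r ^ 2)) hinv) g
  rw [himage] at hcov
  rw [intervalIntegral.integral_of_le hR.le, intervalIntegral.integral_of_le hR.le,
    integral_Ioc_eq_integral_Ioo, integral_Ioc_eq_integral_Ioo, hcov]
  refine setIntegral_congr_fun measurableSet_Ioo fun r hr => ?_
  have : 0 ≤ r / √(R ^ 2 - r ^ 2) := div_nonneg hr.1.le (Real.sqrt_nonneg _)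
  simp only [abs_neg, abs_of_nonneg this, smul_eq_mul]

/-- The double power series of `J₀(ρ√(R² - s²)) cos (b s)` may be integrated term by term. -/
lemma hasSum_integral_J0_mul_cos {R : ℝ} (hR : 0 < R) (b ρ : ℝ) :
    HasSum (fun p : ℕ × ℕ => (-1 : ℝ) ^ (p.1 + p.2) * R ^ (2 * (p.1 + p.2) + 1) /
        Nat.factorial (2 * (p.1 + p.2) + 1) *
        ((p.1 + p.2).choose p.1 * ((ρ ^ 2) ^ p.1 * (b ^ 2) ^ p.2)))
      (∫ s in (0 : ℝ)..R, J0 (√(R ^ 2 - s ^ 2) * ρ) * Real.cos (b * s)) := by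
  have hsum := intervalIntegral.hasSum_integral_of_dominated_convergence
    (μ := volume) (a := 0) (b := R)
    (F := fun (p : ℕ × ℕ) (s : ℝ) =>
      ((-1 : ℝ) ^ p.1 * (ρ ^ 2 * (R ^ 2 - s ^ 2)) ^ p.1 / (4 ^ p.1 * (Nat.factorial p.1 : ℝ) ^ 2)) *
        ((-1 : ℝ) ^ p.2 * (b * s) ^ (2 * p.2) / Nat.factorial (2 * p.2)))
    (f := fun s => J0 (√(R ^ 2 - s ^ 2) * ρ) * Real.cos (b * s))
    (fun p _ => (ρ ^ 2 * R ^ 2) ^ p.1 / Nat.factorial p.1 *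
      ((b ^ 2 * R ^ 2) ^ p.2 / Nat.factorial p.2)) ?_ ?_ ?_ ?_ ?_
  · refine hsum.congr_fun ?_
    rintro ⟨k, m⟩
    have hterm : ∀ s : ℝ,
        ((-1 : ℝ) ^ k * (ρ ^ 2 * (R ^ 2 - s ^ 2)) ^ k / (4 ^ k * (Nat.factorial k : ℝ) ^ 2)) *
          ((-1 : ℝ) ^ m * (b * s) ^ (2 * m) / Nat.factorial (2 * m)) =
        ((-1 : ℝ) ^ (k + m) * (ρ ^ 2) ^ k * (b ^ 2) ^ m /
          (4 ^ k * (Nat.factorial k : ℝ) ^ 2 * Nat.factorial (2 * m))) *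
          ((R ^ 2 - s ^ 2) ^ k * s ^ (2 * m)) := fun s => by
      rw [mul_pow, mul_pow, pow_mul b, pow_add, div_mul_div_comm]
      ring
    have hchoose : ((k + m).choose k : ℝ) * Nat.factorial k * Nat.factorial m =
        Nat.factorial (k + m) := by
      rw [Nat.choose_symm_add]
      exact_mod_cast Nat.add_choose_mul_factorial_mul_factorial k m
    simp only [hterm, intervalIntegral.integral_const_mul, integral_sq_sub_sq_pow_mul_pow,
      ← hchoose]
    field_simp
  · exact fun p => (by fun_prop : Continuous _).aestronglyMeasurable
  · refine fun p => ae_of_all _ fun s hs => ?_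
    rw [Set.uIoc_of_le hR.le] at hs
    have hs1 : 0 ≤ R ^ 2 - s ^ 2 := by nlinarith [hs.1, hs.2]
    have hs2 : s ^ 2 ≤ R ^ 2 := by linarith
    have hs3 : R ^ 2 - s ^ 2 ≤ R ^ 2 := by nlinarith
    have h4 : (1 : ℝ) ≤ 4 ^ p.1 := one_le_pow₀ (by norm_num)
    have hk : (1 : ℝ) ≤ Nat.factorial p.1 := by exact_mod_cast Nat.factorial_pos _
    have hm : (Nat.factorial p.2 : ℝ) ≤ Nat.factorial (2 * p.2) := by
      exact_mod_cast Nat.factorial_le (by omega)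
    rw [pow_mul, mul_pow b s]
    simp only [norm_mul, norm_div, norm_pow, norm_neg, norm_one, one_pow, one_mul,
      Real.norm_of_nonneg hs1, Real.norm_ofNat, Real.norm_eq_abs, sq_abs,
      Nat.abs_cast]
    gcongr
    nlinarith
  · refine ae_of_all _ fun s _ => ?_
    exact (Real.summable_pow_div_factorial _).mul_of_nonneg (Real.summable_pow_div_factorial _)
      (fun _ => by positivity) (fun _ => by positivity)
  · exact intervalIntegrable_const
  · refine ae_of_all _ fun s hs => ?_
    rw [Set.uIoc_of_le hR.le] at hs
    have hs1 : 0 ≤ R ^ 2 - s ^ 2 := by nlinarith [hs.1, hs.2]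
    have hJ := hasSum_J0 (z := √(R ^ 2 - s ^ 2) * ρ) (x := ρ ^ 2 * (R ^ 2 - s ^ 2))
      (by rw [mul_pow, Real.sq_sqrt hs1, mul_comm])
    have hc := Real.hasSum_cos (b * s)
    have hsummable := summable_mul_of_summable_norm hJ.summable.norm hc.summable.norm
    have hprod := hJ.mul hc hsummable
    exact hprod

/-- **Finite Hankel-type integral (Oberhettinger).**
For `R > 0`, `b ≥ 0`, `ρ ≥ 0` with `ρ² + b² > 0`:
`∫_0^R r·J₀(rρ)·cos(b√(R²-r²))/√(R²-r²) dr = sin(R√(ρ²+b²))/√(ρ²+b²)`. -/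
theorem stmt9 (R b ρ : ℝ) (hR : 0 < R) (hb : 0 ≤ b) (hρ : 0 ≤ ρ)
    (hpos : 0 < ρ ^ 2 + b ^ 2) :
    ∫ r in (0 : ℝ)..R,
        r * J0 (r * ρ) * Real.cos (b * Real.sqrt (R ^ 2 - r ^ 2)) /
          Real.sqrt (R ^ 2 - r ^ 2) =
      Real.sin (R * Real.sqrt (ρ ^ 2 + b ^ 2)) / Real.sqrt (ρ ^ 2 + b ^ 2) := by
  have hsubst := integral_comp_sqrt_sq_sub_sq hR
    fun s => J0 (√(R ^ 2 - s ^ 2) * ρ) * Real.cos (b * s)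
  have hcongr : ∫ r in (0 : ℝ)..R, r * J0 (r * ρ) * Real.cos (b * √(R ^ 2 - r ^ 2)) /
        √(R ^ 2 - r ^ 2) =
      ∫ s in (0 : ℝ)..R, J0 (√(R ^ 2 - s ^ 2) * ρ) * Real.cos (b * s) := by
    rw [← hsubst]
    refine intervalIntegral.integral_congr fun r hr => ?_
    rw [Set.uIcc_of_le hR.le] at hr
    have hr1 : 0 ≤ R ^ 2 - r ^ 2 := by nlinarith [hr.1, hr.2]
    simp only [Real.sq_sqrt hr1, sub_sub_cancel, Real.sqrt_sq hr.1]
    ring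
  rw [hcongr]
  have hanti := (Finset.HasAntidiagonal.sigmaAntidiagonalEquivProd.hasSum_iff.2
    (hasSum_integral_J0_mul_cos hR b ρ)).sigma fun n => hasSum_fintype _
  have hq := Real.sqrt_pos.2 hpos
  refine hanti.unique ?_
  refine ((Real.hasSum_sin (R * √(ρ ^ 2 + b ^ 2))).div_const (√(ρ ^ 2 + b ^ 2))).congr_fun
    fun n => ?_
  have hsin : (-1 : ℝ) ^ n * (R * √(ρ ^ 2 + b ^ 2)) ^ (2 * n + 1) / Nat.factorial (2 * n + 1) /
      √(ρ ^ 2 + b ^ 2) =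
      (-1) ^ n * R ^ (2 * n + 1) / Nat.factorial (2 * n + 1) * (ρ ^ 2 + b ^ 2) ^ n := by
    rw [mul_pow, pow_succ (√_), pow_mul (√_), Real.sq_sqrt hpos.le]
    field_simp
  rw [hsin, (Commute.all (ρ ^ 2) (b ^ 2)).add_pow', Finset.mul_sum,
    ← Finset.sum_coe_sort (Finset.HasAntidiagonal.antidiagonal n)]
  refine Fintype.sum_congr _ _ fun p => ?_
  have hp : p.1.1 + p.1.2 = n := Finset.HasAntidiagonal.mem_antidiagonal.1 p.2
  simp [hp]
end
end

section
/- Let L > 0, a ≥ 0, and ξ ∈ ℝ. Then ∫_0^L cos(a√(L²−x²))·cos(xξ)/√(L²−x²) dx = (π/2)·J₀(L√(a²+ξ²)). -/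
open MeasureTheory Metric Real Filter

noncomputable section

/-- The substitution `x = L sin t` in an integral over `[0, L]`. -/
theorem integral_eq_integral_comp_mul_sin (L : ℝ) (hL : 0 < L) (g : ℝ → ℝ) :
    ∫ x in (0 : ℝ)..L, g x = ∫ t in (0 : ℝ)..(π / 2), L * cos t * g (L * sin t) := by
  have hmem : ∀ t ∈ Set.Ioo 0 (π / 2), t ∈ Set.Icc (-(π / 2)) (π / 2) := fun t ht =>
    ⟨by linarith [ht.1, pi_pos], ht.2.le⟩
  have himage : (fun t => L * sin t) '' Set.Ioo 0 (π / 2) = Set.Ioo 0 L := by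
    ext x
    constructor
    · rintro ⟨t, ht, rfl⟩
      have hpos : 0 < sin t := sin_pos_of_pos_of_lt_pi ht.1 (by linarith [ht.2, pi_pos])
      have hlt : sin t < 1 := by
        rw [← sin_pi_div_two]
        exact sin_lt_sin_of_lt_of_le_pi_div_two (hmem t ht).1 le_rfl ht.2
      exact ⟨mul_pos hL hpos, by nlinarith⟩
    · rintro ⟨h0, h1⟩
      have hlt : x / L < 1 := (div_lt_one hL).2 h1
      have hpos : 0 < x / L := div_pos h0 hL
      refine ⟨arcsin (x / L), ⟨arcsin_pos.2 hpos, arcsin_lt_pi_div_two.2 hlt⟩, ?_⟩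
      simp only [sin_arcsin (by linarith) hlt.le]
      field_simp
  rw [intervalIntegral.integral_of_le hL.le, integral_Ioc_eq_integral_Ioo,
    intervalIntegral.integral_of_le pi_div_two_pos.le, integral_Ioc_eq_integral_Ioo, ← himage,
    integral_image_eq_integral_abs_deriv_smul (f' := fun t => L * cos t) measurableSet_Ioo
      (fun t _ => ((hasDerivAt_sin t).const_mul L).hasDerivWithinAt)
      (fun s hs t ht h => injOn_sin (hmem s hs) (hmem t ht) (mul_left_cancel₀ hL.ne' h))]
  refine setIntegral_congr_fun measurableSet_Ioo fun t ht => ?_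
  have hcos : 0 < cos t := cos_pos_of_mem_Ioo ⟨by linarith [ht.1, pi_pos], ht.2⟩
  simp only [abs_of_pos (mul_pos hL hcos), smul_eq_mul]

/-- The even Wallis product in terms of factorials. -/
theorem prod_range_odd_div_even (k : ℕ) :
    ∏ i ∈ Finset.range k, (2 * (i : ℝ) + 1) / (2 * i + 2) =
      (Nat.factorial (2 * k) : ℝ) / (2 ^ (2 * k) * (Nat.factorial k : ℝ) ^ 2) := by
  induction k with
  | zero => simp
  | succ k ih =>
    rw [Finset.prod_range_succ, ih, show 2 * (k + 1) = 2 * k + 1 + 1 by ring,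
      Nat.factorial_succ, Nat.factorial_succ, Nat.factorial_succ]
    have := Nat.factorial_ne_zero k
    push_cast
    field_simp
    ring

/-- Bessel's integral representation of `J₀`. -/
theorem integral_cos_mul_sin_eq_pi_mul_J0 (R : ℝ) :
    ∫ t in (0 : ℝ)..π, cos (R * sin t) = π * J0 R := by
  have hsum := intervalIntegral.hasSum_integral_of_dominated_convergence
    (μ := volume) (a := 0) (b := π)
    (F := fun (k : ℕ) t => (-1 : ℝ) ^ k * (R * sin t) ^ (2 * k) / (Nat.factorial (2 * k) : ℝ))
    (f := fun t => cos (R * sin t))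
    (fun k _ => |R| ^ (2 * k) / (Nat.factorial (2 * k) : ℝ))
    (fun k => by fun_prop)
    (fun k => Eventually.of_forall fun t _ => by
      rw [norm_div, norm_mul, norm_pow, norm_neg, norm_one, one_pow, one_mul, norm_pow,
        Real.norm_eq_abs, Real.norm_natCast, abs_mul]
      gcongr
      exact mul_le_of_le_one_right (abs_nonneg R) (abs_sin_le_one t))
    (Eventually.of_forall fun t _ =>
      (Real.summable_pow_div_factorial |R|).comp_injective
        (i := fun k : ℕ => 2 * k) (mul_right_injective₀ two_ne_zero))
    (by simp)
    (Eventually.of_forall fun t _ => Real.hasSum_cos (R * sin t))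
  rw [← hsum.tsum_eq, J0, ← tsum_mul_left]
  refine tsum_congr fun k => ?_
  have hterm : ∀ t, (-1 : ℝ) ^ k * (R * sin t) ^ (2 * k) / (Nat.factorial (2 * k) : ℝ) =
      (-1 : ℝ) ^ k * R ^ (2 * k) / (Nat.factorial (2 * k) : ℝ) * sin t ^ (2 * k) := fun t => by
    rw [mul_pow]; ring
  simp only [hterm]
  rw [intervalIntegral.integral_const_mul, integral_sin_pow_even, prod_range_odd_div_even]
  have := Nat.factorial_ne_zero (2 * k)
  have := Nat.factorial_ne_zero k
  field_simp

/-- A two-frequency form of Bessel's integral on a quarter period. -/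
theorem integral_cos_mul_cos_mul_cos_mul_sin (p q : ℝ) :
    ∫ t in (0 : ℝ)..(π / 2), cos (p * cos t) * cos (q * sin t) =
      π / 2 * J0 (√(p ^ 2 + q ^ 2)) := by
  obtain ⟨R, φ, hR, hq, hp⟩ : ∃ R φ : ℝ, R = √(p ^ 2 + q ^ 2) ∧ R * cos φ = q ∧ R * sin φ = p := by
    refine ⟨‖(⟨q, p⟩ : ℂ)‖, Complex.arg ⟨q, p⟩, ?_, Complex.norm_mul_cos_arg _,
      Complex.norm_mul_sin_arg _⟩
    rw [Complex.norm_eq_sqrt_sq_add_sq, add_comm]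
  rw [← hR]
  set F : ℝ → ℝ := fun t => cos (R * sin t) with hF
  have hcont : Continuous F := by fun_prop
  have hper : Function.Periodic F π := fun t => by simp [hF, sin_add_pi]
  have hprod : ∀ t, cos (p * cos t) * cos (q * sin t) =
      2⁻¹ * (F (t + φ) + F (-t + φ)) := fun t => by
    have h1 : R * sin (t + φ) = p * cos t + q * sin t := by rw [sin_add, ← hp, ← hq]; ring
    have h2 : R * sin (-t + φ) = p * cos t - q * sin t := by
      rw [sin_add, sin_neg, cos_neg, ← hp, ← hq]; ring
    simp only [hF, h1, h2, cos_add, cos_sub]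
    ring
  have hint : ∀ f : ℝ → ℝ, Continuous f → ∀ a b, IntervalIntegrable f volume a b :=
    fun f hf a b => hf.intervalIntegrable a b
  simp only [hprod]
  rw [intervalIntegral.integral_const_mul, intervalIntegral.integral_add
    (hint _ (by fun_prop) _ _) (hint _ (by fun_prop) _ _),
    intervalIntegral.integral_comp_neg (fun t => F (t + φ)), neg_zero, add_comm,
    intervalIntegral.integral_add_adjacent_intervals
      (hint _ (by fun_prop) _ _) (hint _ (by fun_prop) _ _),
    intervalIntegral.integral_comp_add_right,
    show π / 2 + φ = -(π / 2) + φ + π by ring, hper.intervalIntegral_add_eq _ 0, zero_add,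
    integral_cos_mul_sin_eq_pi_mul_J0]
  ring

/-- **Finite cosine transform yielding a Bessel function (Oberhettinger).**
For `L > 0`, `a ≥ 0`, `ξ ∈ ℝ`:
`∫_0^L cos(a√(L²-x²))·cos(xξ)/√(L²-x²) dx = (π/2)·J₀(L√(a²+ξ²))`. -/
theorem stmt11 (L a ξ : ℝ) (hL : 0 < L) (ha : 0 ≤ a) :
    ∫ x in (0 : ℝ)..L,
        Real.cos (a * Real.sqrt (L ^ 2 - x ^ 2)) * Real.cos (x * ξ) /
          Real.sqrt (L ^ 2 - x ^ 2) =
      (π / 2) * J0 (L * Real.sqrt (a ^ 2 + ξ ^ 2)) := by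
  have hR : L * √(a ^ 2 + ξ ^ 2) = √((a * L) ^ 2 + (L * ξ) ^ 2) := by
    rw [show (a * L) ^ 2 + (L * ξ) ^ 2 = L ^ 2 * (a ^ 2 + ξ ^ 2) by ring,
      sqrt_mul (sq_nonneg L), sqrt_sq hL.le]
  rw [hR, ← integral_cos_mul_cos_mul_cos_mul_sin, integral_eq_integral_comp_mul_sin L hL,
    intervalIntegral.integral_of_le pi_div_two_pos.le, integral_Ioc_eq_integral_Ioo,
    intervalIntegral.integral_of_le pi_div_two_pos.le, integral_Ioc_eq_integral_Ioo]
  refine setIntegral_congr_fun measurableSet_Ioo fun t ht => ?_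
  have hcos : 0 < cos t := cos_pos_of_mem_Ioo ⟨by linarith [ht.1, pi_pos], ht.2⟩
  have hsqrt : √(L ^ 2 - (L * sin t) ^ 2) = L * cos t := by
    rw [show L ^ 2 - (L * sin t) ^ 2 = (L * cos t) ^ 2 by rw [mul_pow, mul_pow, cos_sq']; ring,
      sqrt_sq (mul_pos hL hcos).le]
  simp only [hsqrt]
  rw [mul_div_cancel₀ _ (mul_pos hL hcos).ne']
  congr 2 <;> ring
end
end

section
/- Let L, R > 0, let f be a Schwartz function on ℝ², let g = Rf, and assume g(−x,r) = g(x,r) for all x, r (this holds e.g. when f(−x,y) = f(x,y)). For k, l ∈ ℕ₀ set c_{k,l} = (ε_k·ε_l/(L·R)) ∫_0^R ∫_0^L cos(kπ√(L²−x'²)/L)·cos(lπ√(R²−r'²)/R)·x'·r'·g(x',r') dx' dr'. Then for all 0 < x < L and 0 < r < R, the double series Σ_{k=0}^∞ Σ_{l=0}^∞ c_{k,l}·cos(kπ√(L²−x²)/L)·cos(lπ√(R²−r²)/R)/(√(L²−x²)·√(R²−r²)) converges and equals g(x,r). -/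
open MeasureTheory Metric Real Filter

noncomputable section

/-- Spherical (circular) Radon transform in dimension `n = 1`:
`(Rf)(x,r) = (1/(2π)) ∫_{S¹} f(x+rξ, rη) dS₁(ξ,η)`, the circle integral written
via the arclength parametrization `(ξ,η) = (cos θ, sin θ)`. -/
noncomputable def circleRadon (f : ℝ × ℝ → ℂ) (x r : ℝ) : ℂ :=
  ((1 / (2 * π) : ℝ) : ℂ) *
    ∫ θ in (0 : ℝ)..(2 * π), f (x + r * Real.cos θ, r * Real.sin θ)

/-- Neumann's numbers: `ε₀ = 1`, `ε_l = 2` for `l ≥ 1`. -/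
def neumannEps (l : ℕ) : ℝ := if l = 0 then 1 else 2

/-- A function that takes equal values at the ends of an interval and has a square integrable right
derivative has absolutely summable Fourier coefficients. -/
lemma summable_fourierCoeffOn_of_hasDerivWithinAt {a b : ℝ} (hab : a < b) {F F' : ℝ → ℂ}
    (hF : Continuous F) (hper : F a = F b)
    (hderiv : ∀ x ∈ Set.Ioo a b, HasDerivWithinAt F (F' x) (Set.Ioi x) x)
    (hF' : MemLp F' 2 (volume.restrict (Set.Ioc a b))) :
    Summable (fourierCoeffOn hab F) := by
  have hint : IntervalIntegrable F' volume a b := by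
    rw [intervalIntegrable_iff_integrableOn_Ioc_of_le hab.le]
    exact hF'.integrable (by norm_num)
  have hsq := (hasSum_sq_fourierCoeffOn hab hF').summable
  have hinv : Summable fun n : ℤ => 1 / (n : ℝ) ^ 2 :=
    Real.summable_one_div_int_pow.mpr one_lt_two
  have hbound := ((hsq.add hinv).mul_left (b - a)).add
    (summable_of_ne_finset_zero (s := {0}) (f := fun n : ℤ =>
      if n = 0 then ‖fourierCoeffOn hab F 0‖ else 0) (by intro n hn; simp at hn; simp [hn]))
  refine Summable.of_norm_bounded hbound fun n => ?_
  by_cases hn : n = 0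
  · subst hn
    have : 0 < b - a := sub_pos.mpr hab
    simp only [if_true, le_add_iff_nonneg_left]
    positivity
  · rw [if_neg hn, add_zero, fourierCoeffOn_of_hasDeriv_right hab hn hF.continuousOn
      (by rwa [min_eq_left hab.le, max_eq_right hab.le]) hint, hper, sub_self, mul_zero, zero_sub,
      norm_mul, norm_neg, norm_mul, ← Complex.ofReal_sub, Complex.norm_real, Real.norm_eq_abs,
      abs_of_pos (sub_pos.mpr hab)]
    have hn' : 0 < |(n : ℝ)| := abs_pos.mpr (Int.cast_ne_zero.mpr hn)
    have hπ : ‖(1 : ℂ) / (-2 * π * Complex.I * n)‖ ≤ 1 / |(n : ℝ)| := by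
      simp only [norm_div, norm_mul, norm_neg, norm_one, Complex.norm_I, Complex.norm_real,
        Complex.norm_intCast, Complex.norm_ofNat, mul_one, Real.norm_eq_abs, abs_of_pos Real.pi_pos]
      refine one_div_le_one_div_of_le hn' (le_mul_of_one_le_left hn'.le ?_)
      linarith [Real.pi_gt_three]
    have hsq' : 1 / (n : ℝ) ^ 2 = (1 / |(n : ℝ)|) ^ 2 := by rw [div_pow, sq_abs, one_pow]
    rw [hsq']
    set y := ‖fourierCoeffOn hab F' n‖
    have hy : 0 ≤ y := norm_nonneg _
    have hz : 0 < 1 / |(n : ℝ)| := by positivity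
    calc _ ≤ 1 / |(n : ℝ)| * ((b - a) * y) := by
          gcongr
      _ = (b - a) * (1 / |(n : ℝ)| * y) := by ring
      _ ≤ _ := by
          gcongr
          nlinarith [sq_nonneg (1 / |(n : ℝ)| - y)]

lemma hasSum_fourierCoeffOn {a b : ℝ} (hab : a < b) {F : ℝ → ℂ} (hF : Continuous F)
    (hper : F a = F b) (hsum : Summable (fourierCoeffOn hab F)) {x : ℝ} (hx : x ∈ Set.Ioc a b) :
    HasSum (fun n : ℤ => fourierCoeffOn hab F n * fourier n (x : AddCircle (b - a))) (F x) := by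
  have : Fact (0 < b - a) := ⟨sub_pos.mpr hab⟩
  have hcont : Continuous (AddCircle.liftIoc (b - a) a F) :=
    AddCircle.liftIoc_continuous (by rwa [add_sub_cancel]) hF.continuousOn
  have key := has_pointwise_sum_fourier_series_of_summable (T := b - a) (f := ⟨_, hcont⟩) hsum x
  rw [ContinuousMap.coe_mk, AddCircle.liftIoc_coe_apply (by rwa [add_sub_cancel])] at key
  exact key

lemma fourier_symm_interval_apply (L : ℝ) (n : ℤ) (x : ℝ) :
    fourier n (x : AddCircle (L - -L)) = Complex.exp (((n * π / L * x : ℝ) : ℂ) * Complex.I) := by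
  rw [fourier_coe_apply]
  congr 1
  push_cast
  rcases eq_or_ne L 0 with rfl | hL
  · simp
  · have : (L : ℂ) ≠ 0 := mod_cast hL
    field_simp
    ring

/-- The Fourier coefficients of an even function on a symmetric interval are cosine integrals. -/
lemma fourierCoeffOn_of_even {L : ℝ} (hL : -L < L) {F : ℝ → ℂ} (hF : Continuous F)
    (heven : ∀ x, F (-x) = F x) (n : ℤ) :
    fourierCoeffOn hL F n =
      ((1 / L : ℝ) : ℂ) * ∫ t in (0 : ℝ)..L, (Real.cos (n * π / L * t) : ℂ) * F t := by
  have hint (a b : ℝ) (m : ℤ) : IntervalIntegrable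
      (fun t : ℝ => Complex.exp (((m * π / L * t : ℝ) : ℂ) * Complex.I) * F t) volume a b := by
    apply Continuous.intervalIntegrable
    fun_prop
  rw [fourierCoeffOn_eq_integral]
  simp_rw [fourier_symm_interval_apply, smul_eq_mul]
  rw [← intervalIntegral.integral_add_adjacent_intervals (hint (-L) 0 (-n)) (hint 0 L (-n))]
  have hneg : ∫ t in (-L)..0, Complex.exp ((((-n : ℤ) * π / L * t : ℝ) : ℂ) * Complex.I) * F t =
      ∫ t in (0 : ℝ)..L, Complex.exp (((n * π / L * t : ℝ) : ℂ) * Complex.I) * F t := by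
    rw [← neg_zero, ← intervalIntegral.integral_comp_neg, neg_zero]
    refine intervalIntegral.integral_congr fun t _ => ?_
    simp only [heven]
    congr 4
    push_cast
    ring
  rw [hneg, ← intervalIntegral.integral_add (hint 0 L n) (hint 0 L (-n)), Complex.real_smul]
  have hcos : ∀ t : ℝ, Complex.exp (((n * π / L * t : ℝ) : ℂ) * Complex.I) * F t +
      Complex.exp ((((-n : ℤ) * π / L * t : ℝ) : ℂ) * Complex.I) * F t =
      2 * ((Real.cos (n * π / L * t) : ℂ) * F t) := by
    intro t
    rw [Complex.ofReal_cos, Complex.cos]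
    have : ((((-n : ℤ) * π / L * t : ℝ) : ℂ) * Complex.I) =
        -((n * π / L * t : ℝ) : ℂ) * Complex.I := by push_cast; ring
    rw [this]
    ring
  simp_rw [hcos]
  rw [intervalIntegral.integral_const_mul, ← mul_assoc]
  congr 1
  have : (L : ℂ) ≠ 0 := by
    have : L ≠ 0 := by linarith
    exact mod_cast this
  push_cast
  field_simp
  ring

/-- Pointwise convergence of the cosine series of an even function. -/
lemma hasSum_cos_of_even {L : ℝ} (hL : -L < L) {F : ℝ → ℂ} (hF : Continuous F)
    (heven : ∀ x, F (-x) = F x) (hsum : Summable (fourierCoeffOn hL F)) {x : ℝ}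
    (hx : x ∈ Set.Ioc (-L) L) :
    HasSum (fun n : ℕ => (((neumannEps n / L : ℝ) : ℂ) *
      ∫ t in (0 : ℝ)..L, (Real.cos (n * π / L * t) : ℂ) * F t) * (Real.cos (n * π / L * x) : ℂ))
      (F x) := by
  have key := (hasSum_fourierCoeffOn hL hF (heven L) hsum hx).nat_add_neg
  have hzero := hasSum_ite_eq (0 : ℕ) (fourierCoeffOn hL F 0)
  have key := key.sub hzero
  rw [fourier_zero, mul_one, add_sub_cancel_right] at key
  convert! key using 1
  funext n
  simp_rw [fourier_symm_interval_apply, fourierCoeffOn_of_even hL hF heven]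
  rcases eq_or_ne n 0 with rfl | hn
  · simp [neumannEps]
  · rw [if_neg hn, sub_zero, neumannEps, if_neg hn, Complex.ofReal_cos (_ * x), Complex.cos]
    have h1 (t : ℝ) : Real.cos (((-n : ℤ) : ℝ) * π / L * t) = Real.cos (n * π / L * t) := by
      rw [← Real.cos_neg]
      congr 1
      push_cast
      ring
    have h2 : ((((-n : ℤ) * π / L * x : ℝ) : ℂ) * Complex.I) =
        -((n * π / L * x : ℝ) : ℂ) * Complex.I := by push_cast; ring
    simp_rw [h1, h2]
    push_cast
    ring

/-- The substitution `u = √(L² - x²)` on `[0, L]`. -/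
lemma integral_comp_sqrt_sq_sub_sq_s13 {L : ℝ} (hL : 0 < L) {w h : ℝ → ℂ} (hw : Continuous w)
    (hh : Continuous h) :
    ∫ t in (0 : ℝ)..L, w t * (t * h (√(L ^ 2 - t ^ 2))) =
      ∫ x in (0 : ℝ)..L, w (√(L ^ 2 - x ^ 2)) * (x * h x) := by
  have hs : ∀ t : ℝ, HasDerivAt (fun t => L * Real.sin t) (L * Real.cos t) t := fun t =>
    (Real.hasDerivAt_sin t).const_mul L
  have hc : ∀ t : ℝ, HasDerivAt (fun t => L * Real.cos t) (L * -Real.sin t) t := fun t =>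
    (Real.hasDerivAt_cos t).const_mul L
  have e1 := intervalIntegral.integral_deriv_smul_comp (a := 0) (b := π / 2)
    (g := fun x : ℝ => w (√(L ^ 2 - x ^ 2)) * (x * h x))
    (fun t _ => hs t) (by fun_prop) (by fun_prop)
  have e2 := intervalIntegral.integral_deriv_smul_comp (a := 0) (b := π / 2)
    (g := fun t : ℝ => w t * (t * h (√(L ^ 2 - t ^ 2))))
    (fun t _ => hc t) (by fun_prop) (by fun_prop)
  simp only [Real.sin_zero, Real.sin_pi_div_two, Real.cos_zero, Real.cos_pi_div_two, mul_zero,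
    mul_one, Function.comp_apply] at e1 e2
  rw [← e1, intervalIntegral.integral_symm, ← e2, ← intervalIntegral.integral_neg]
  refine intervalIntegral.integral_congr fun t ht => ?_
  rw [Set.uIcc_of_le (by positivity)] at ht
  have hct : 0 ≤ L * Real.cos t :=
    mul_nonneg hL.le (Real.cos_nonneg_of_mem_Icc ⟨by linarith [ht.1, Real.pi_pos], ht.2⟩)
  have hst : 0 ≤ L * Real.sin t :=
    mul_nonneg hL.le (Real.sin_nonneg_of_nonneg_of_le_pi ht.1 (by linarith [ht.2, Real.pi_pos]))
  have r1 : √(L ^ 2 - (L * Real.sin t) ^ 2) = L * Real.cos t := by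
    rw [← Real.sqrt_sq hct]
    congr 1
    linear_combination L ^ 2 * Real.sin_sq_add_cos_sq t * (-1)
  have r2 : √(L ^ 2 - (L * Real.cos t) ^ 2) = L * Real.sin t := by
    rw [← Real.sqrt_sq hst]
    congr 1
    linear_combination L ^ 2 * Real.sin_sq_add_cos_sq t * (-1)
  simp only [r1, r2, Complex.real_smul]
  push_cast
  ring

lemma hasDerivWithinAt_abs_Ioi (u : ℝ) :
    HasDerivWithinAt (fun v : ℝ => |v|) (if u < 0 then -1 else 1) (Set.Ioi u) u := by
  split_ifs with hu
  · exact (hasDerivAt_abs_neg hu).hasDerivWithinAt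
  · have hu : 0 ≤ u := not_lt.mp hu
    exact (hasDerivWithinAt_id u _).congr (fun v hv => abs_of_nonneg (hu.trans (le_of_lt hv)))
      (abs_of_nonneg hu)

lemma summable_fourierCoeffOn_abs_mul_comp_sqrt {L : ℝ} (hL : -L < L) {h : ℝ → ℂ}
    (hd : Differentiable ℝ h) {C : ℝ} (hC : ∀ x, ‖deriv h x‖ ≤ C * |x|) :
    Summable (fourierCoeffOn hL fun u : ℝ => ((|u| : ℝ) : ℂ) * h (√(L ^ 2 - u ^ 2))) := by
  have hL0 : 0 < L := by linarith
  have hh := hd.continuous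
  have hcont : Continuous fun u : ℝ => h (√(L ^ 2 - u ^ 2)) := by fun_prop
  have hC0 : 0 ≤ C := by simpa using (norm_nonneg _).trans (hC 1)
  refine summable_fourierCoeffOn_of_hasDerivWithinAt hL (F' := fun u =>
    (((if u < 0 then -1 else 1 : ℝ)) : ℂ) * h (√(L ^ 2 - u ^ 2)) +
      ((|u| : ℝ) : ℂ) * ((-u / √(L ^ 2 - u ^ 2)) • deriv h (√(L ^ 2 - u ^ 2)))) (by fun_prop) (by simp)
    (fun u hu => ?_) ?_
  · have hpos : 0 < L ^ 2 - u ^ 2 := by nlinarith [hu.1, hu.2]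
    have hsqrt : HasDerivAt (fun u : ℝ => √(L ^ 2 - u ^ 2)) (-u / √(L ^ 2 - u ^ 2)) u := by
      convert ((hasDerivAt_pow 2 u).const_sub (L ^ 2)).sqrt hpos.ne' using 1
      field_simp
      norm_num [mul_comm]
    exact (hasDerivWithinAt_abs_Ioi u).ofReal_comp.mul
      ((hd _).hasDerivAt.scomp u hsqrt).hasDerivWithinAt
  · obtain ⟨M, hM⟩ := (isCompact_Icc (a := -L) (b := L)).exists_bound_of_continuousOn
      hcont.continuousOn
    refine MemLp.of_bound (Measurable.aestronglyMeasurable ?_) (M + L * (C * L)) ?_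
    · have hm : Measurable fun u : ℝ => (if u < 0 then -1 else 1 : ℝ) :=
        Measurable.ite measurableSet_Iio measurable_const measurable_const
      have hm' : Measurable (deriv h) := measurable_deriv h
      fun_prop
    · refine (ae_restrict_iff' measurableSet_Ioc).mpr (Eventually.of_forall fun u hu => ?_)
      have hu' : |u| ≤ L := abs_le.mpr ⟨hu.1.le, hu.2⟩
      refine (norm_add_le _ _).trans (add_le_add ?_ ?_)
      · rw [norm_mul]
        have : ‖(((if u < 0 then -1 else 1 : ℝ)) : ℂ)‖ = 1 := by split_ifs <;> simp
        rw [this, one_mul]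
        exact hM u ⟨hu.1.le, hu.2⟩
      · rw [norm_mul, norm_smul, Complex.norm_real, Real.norm_eq_abs, Real.norm_eq_abs, abs_abs,
          abs_div, abs_neg]
        set s := √(L ^ 2 - u ^ 2)
        refine mul_le_mul hu' ?_ (by positivity) hL0.le
        calc |u| / |s| * ‖deriv h s‖ ≤ |u| / |s| * (C * |s|) := by gcongr; exact hC s
          _ = C * |u| * (|s| / |s|) := by ring
          _ ≤ C * |u| * 1 := by gcongr; exact div_self_le_one _
          _ ≤ C * L := by rw [mul_one]; gcongr

/-- Expansion of a function with vanishing derivative at the origin in the functions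
`cos (nπ√(L² - x²)/L) / √(L² - x²)`. -/
lemma hasSum_cos_sqrt {L : ℝ} (hL : 0 < L) {h : ℝ → ℂ} (hd : Differentiable ℝ h) {C : ℝ}
    (hC : ∀ x, ‖deriv h x‖ ≤ C * |x|) {x : ℝ} (hx : 0 < x) (hxL : x < L) :
    HasSum (fun n : ℕ => (((neumannEps n / L : ℝ) : ℂ) *
        ∫ t in (0 : ℝ)..L, (Real.cos (n * π / L * √(L ^ 2 - t ^ 2)) : ℂ) * (t * h t)) *
        ((Real.cos (n * π / L * √(L ^ 2 - x ^ 2)) / √(L ^ 2 - x ^ 2) : ℝ) : ℂ)) (h x) := by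
  have hL' : -L < L := by linarith
  have hh := hd.continuous
  have hpos : 0 < L ^ 2 - x ^ 2 := by nlinarith
  set s := √(L ^ 2 - x ^ 2) with hs
  have hs0 : 0 < s := Real.sqrt_pos.mpr hpos
  have hsL : s ≤ L := by
    rw [hs, Real.sqrt_le_left hL.le]
    nlinarith
  have hback : √(L ^ 2 - s ^ 2) = x := by
    rw [hs, Real.sq_sqrt hpos.le, sub_sub_cancel, Real.sqrt_sq hx.le]
  have key := (hasSum_cos_of_even hL' (F := fun u : ℝ => ((|u| : ℝ) : ℂ) * h (√(L ^ 2 - u ^ 2)))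
    (by fun_prop) (by simp) (summable_fourierCoeffOn_abs_mul_comp_sqrt hL' hd hC)
    (x := s) ⟨by linarith, hsL⟩).mul_right ((s : ℂ)⁻¹)
  have hsC : (s : ℂ) ≠ 0 := mod_cast hs0.ne'
  simp only [abs_of_pos hs0, hback] at key
  rw [mul_comm (s : ℂ), mul_inv_cancel_right₀ hsC] at key
  convert! key using 1
  funext n
  rw [← integral_comp_sqrt_sq_sub_sq_s13 hL (w := fun t => (Real.cos (n * π / L * t) : ℂ))
    (by fun_prop) hh]
  have habs : ∫ t in (0 : ℝ)..L, (Real.cos (n * π / L * t) : ℂ) * (((|t| : ℝ) : ℂ) * h (√(L ^ 2 - t ^ 2)))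
      = ∫ t in (0 : ℝ)..L, (Real.cos (n * π / L * t) : ℂ) * (t * h (√(L ^ 2 - t ^ 2))) := by
    refine intervalIntegral.integral_congr fun t ht => ?_
    rw [Set.uIcc_of_le hL.le] at ht
    simp only [abs_of_nonneg ht.1]
  rw [habs]
  push_cast
  ring

lemma exists_lipschitzWith_schwartz {E F : Type*} [NormedAddCommGroup E] [NormedSpace ℝ E]
    [NormedAddCommGroup F] [NormedSpace ℝ F] (f : SchwartzMap E F) :
    ∃ K : NNReal, LipschitzWith K f := by
  let S := SchwartzMap.seminorm ℝ 0 0 (SchwartzMap.fderivCLM ℝ E F f)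
  refine ⟨⟨S, apply_nonneg _ _⟩, lipschitzWith_of_nnnorm_fderiv_le f.differentiable fun x => ?_⟩
  exact SchwartzMap.norm_le_seminorm ℝ (SchwartzMap.fderivCLM ℝ E F f) x

lemma exists_lipschitzWith_fderiv_schwartz {E F : Type*} [NormedAddCommGroup E] [NormedSpace ℝ E]
    [NormedAddCommGroup F] [NormedSpace ℝ F] (f : SchwartzMap E F) :
    ∃ K : NNReal, LipschitzWith K (fderiv ℝ f) :=
  exists_lipschitzWith_schwartz (SchwartzMap.fderivCLM ℝ E F f)

/-- Differentiation under the integral sign along a family of lines. -/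
lemma hasDerivAt_integral_schwartz_add_smul {E F : Type*} [NormedAddCommGroup E] [NormedSpace ℝ E]
    [NormedAddCommGroup F] [NormedSpace ℝ F] (f : SchwartzMap E F) {p v : ℝ → E}
    (hp : Continuous p) (hv : Continuous v) (a b t₀ : ℝ) :
    HasDerivAt (fun t => ∫ θ in a..b, f (p θ + t • v θ))
      (∫ θ in a..b, fderiv ℝ f (p θ + t₀ • v θ) (v θ)) t₀ := by
  have hf := f.continuous
  have hf' : Continuous (fderiv ℝ f) := (SchwartzMap.fderivCLM ℝ E F f).continuous
  refine (intervalIntegral.hasDerivAt_integral_of_dominated_loc_of_deriv_le (s := Set.univ)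
    (F' := fun t θ => fderiv ℝ f (p θ + t • v θ) (v θ))
    (bound := fun θ => SchwartzMap.seminorm ℝ 0 0 (SchwartzMap.fderivCLM ℝ E F f) * ‖v θ‖)
    univ_mem (Eventually.of_forall fun t => Continuous.aestronglyMeasurable (by fun_prop))
    (Continuous.intervalIntegrable (by fun_prop) _ _)
    (Continuous.aestronglyMeasurable (by fun_prop)) ?_
    (Continuous.intervalIntegrable (by fun_prop) _ _) ?_).2
  · refine Eventually.of_forall fun θ _ t _ => ((fderiv ℝ f _).le_opNorm _).trans ?_
    gcongr
    exact SchwartzMap.norm_le_seminorm ℝ (SchwartzMap.fderivCLM ℝ E F f) _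
  · refine Eventually.of_forall fun θ _ t _ => ?_
    have hline : HasDerivAt (fun t : ℝ => p θ + t • v θ) (v θ) t := by
      simpa using ((hasDerivAt_id t).smul_const (v θ)).const_add (p θ)
    exact (f.differentiable _).hasFDerivAt.comp_hasDerivAt t hline

/-- Average over the circle of centre `(x, 0)` and radius `r` of the derivative of `f` along the
vector field `v`. -/
def circleDerivAverage (f : SchwartzMap (ℝ × ℝ) ℂ) (v : ℝ → ℝ × ℝ) (x r : ℝ) : ℂ :=
  ((1 / (2 * π) : ℝ) : ℂ) *
    ∫ θ in (0 : ℝ)..(2 * π), fderiv ℝ f (x + r * Real.cos θ, r * Real.sin θ) (v θ)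

lemma hasDerivAt_circleRadon_center (f : SchwartzMap (ℝ × ℝ) ℂ) (x r : ℝ) :
    HasDerivAt (fun x => circleRadon f x r) (circleDerivAverage f (fun _ => (1, 0)) x r) x := by
  have key := (hasDerivAt_integral_schwartz_add_smul f
    (p := fun θ => (r * Real.cos θ, r * Real.sin θ)) (v := fun _ => (1, 0)) (by fun_prop)
    (by fun_prop) 0 (2 * π) x).const_mul ((1 / (2 * π) : ℝ) : ℂ)
  simpa [circleRadon, circleDerivAverage, add_comm] using key

lemma hasDerivAt_circleRadon_radius (f : SchwartzMap (ℝ × ℝ) ℂ) (x r : ℝ) :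
    HasDerivAt (fun r => circleRadon f x r)
      (circleDerivAverage f (fun θ => (Real.cos θ, Real.sin θ)) x r) r := by
  have key := (hasDerivAt_integral_schwartz_add_smul f
    (p := fun _ => (x, 0)) (v := fun θ => (Real.cos θ, Real.sin θ)) (by fun_prop)
    (by fun_prop) 0 (2 * π) r).const_mul ((1 / (2 * π) : ℝ) : ℂ)
  simpa [circleRadon, circleDerivAverage] using key

lemma continuous_circleRadon (f : SchwartzMap (ℝ × ℝ) ℂ) :
    Continuous fun q : ℝ × ℝ => circleRadon f q.1 q.2 := by
  have hf := f.continuous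
  refine continuous_const.mul
    (intervalIntegral.continuous_parametric_intervalIntegral_of_continuous' ?_ _ _)
  simp only [Function.uncurry_def]
  fun_prop

lemma continuous_circleDerivAverage (f : SchwartzMap (ℝ × ℝ) ℂ) {v : ℝ → ℝ × ℝ}
    (hv : Continuous v) : Continuous fun q : ℝ × ℝ => circleDerivAverage f v q.1 q.2 := by
  have hf' : Continuous (fderiv ℝ f) := (SchwartzMap.fderivCLM ℝ (ℝ × ℝ) ℂ f).continuous
  refine continuous_const.mul
    (intervalIntegral.continuous_parametric_intervalIntegral_of_continuous' ?_ _ _)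
  simp only [Function.uncurry_def]
  fun_prop

lemma norm_circleDerivAverage_sub_le (f : SchwartzMap (ℝ × ℝ) ℂ) {K : NNReal}
    (hK : LipschitzWith K (fderiv ℝ f)) {v : ℝ → ℝ × ℝ} (hv : Continuous v) (hv1 : ∀ θ, ‖v θ‖ ≤ 1)
    {x r x' r' δ : ℝ} (hδ : ∀ θ, ‖((x + r * Real.cos θ, r * Real.sin θ) : ℝ × ℝ) -
      (x' + r' * Real.cos θ, r' * Real.sin θ)‖ ≤ δ) :
    ‖circleDerivAverage f v x r - circleDerivAverage f v x' r'‖ ≤ K * δ := by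
  have hf' : Continuous (fderiv ℝ f) := (SchwartzMap.fderivCLM ℝ (ℝ × ℝ) ℂ f).continuous
  rw [circleDerivAverage, circleDerivAverage, ← mul_sub, ← intervalIntegral.integral_sub
    (Continuous.intervalIntegrable (by fun_prop) _ _)
    (Continuous.intervalIntegrable (by fun_prop) _ _), norm_mul]
  have hbound := intervalIntegral.norm_integral_le_of_norm_le_const (a := 0) (b := 2 * π)
    (C := K * δ) (f := fun θ => fderiv ℝ f (x + r * Real.cos θ, r * Real.sin θ) (v θ) -
      fderiv ℝ f (x' + r' * Real.cos θ, r' * Real.sin θ) (v θ)) (fun θ _ => by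
    rw [← sub_apply]
    refine (ContinuousLinearMap.le_of_opNorm_le_of_le _ (hK.norm_sub_le _ _) (hv1 θ)).trans ?_
    rw [mul_one]
    gcongr
    exact hδ θ)
  rw [sub_zero, abs_of_pos Real.two_pi_pos] at hbound
  rw [Complex.norm_real, Real.norm_eq_abs, abs_of_pos (by positivity)]
  calc _ ≤ 1 / (2 * π) * (K * δ * (2 * π)) := by gcongr
    _ = K * δ := by field_simp

lemma circleDerivAverage_radius_zero (f : SchwartzMap (ℝ × ℝ) ℂ) (x : ℝ) :
    circleDerivAverage f (fun θ => (Real.cos θ, Real.sin θ)) x 0 = 0 := by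
  have hsplit (θ : ℝ) : ((Real.cos θ, Real.sin θ) : ℝ × ℝ) =
      Real.cos θ • (1, 0) + Real.sin θ • (0, 1) := by simp
  simp only [circleDerivAverage, zero_mul, add_zero]
  simp_rw [hsplit, map_add, map_smul]
  rw [intervalIntegral.integral_add (Continuous.intervalIntegrable (by fun_prop) _ _)
    (Continuous.intervalIntegrable (by fun_prop) _ _), intervalIntegral.integral_smul_const,
    intervalIntegral.integral_smul_const]
  simp

lemma norm_circleDerivAverage_radius_le (f : SchwartzMap (ℝ × ℝ) ℂ) {K : NNReal}
    (hK : LipschitzWith K (fderiv ℝ f)) (x r : ℝ) :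
    ‖circleDerivAverage f (fun θ => (Real.cos θ, Real.sin θ)) x r‖ ≤ K * |r| := by
  rw [← sub_zero (circleDerivAverage _ _ _ _), ← circleDerivAverage_radius_zero f x]
  refine norm_circleDerivAverage_sub_le f hK (by fun_prop)
    (fun θ => max_le (Real.abs_cos_le_one θ) (Real.abs_sin_le_one θ)) fun θ => ?_
  refine max_le ?_ ?_
  · simpa [abs_mul] using mul_le_of_le_one_right (abs_nonneg r) (Real.abs_cos_le_one θ)
  · simpa [abs_mul] using mul_le_of_le_one_right (abs_nonneg r) (Real.abs_sin_le_one θ)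

lemma norm_circleDerivAverage_center_le (f : SchwartzMap (ℝ × ℝ) ℂ) {K : NNReal}
    (hK : LipschitzWith K (fderiv ℝ f)) {r : ℝ}
    (heven : ∀ x, circleRadon f (-x) r = circleRadon f x r) (x : ℝ) :
    ‖circleDerivAverage f (fun _ => (1, 0)) x r‖ ≤ K * |x| := by
  have hzero : circleDerivAverage f (fun _ => (1, 0)) 0 r = 0 := by
    have h1 := hasDerivAt_circleRadon_center f 0 r
    have h2 := deriv_comp_neg (fun x => circleRadon f x r) 0
    simp only [heven, neg_zero, h1.deriv] at h2
    exact self_eq_neg.mp h2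
  rw [← sub_zero (circleDerivAverage _ _ _ _), ← hzero]
  refine norm_circleDerivAverage_sub_le f hK (by fun_prop) (fun θ => by simp) fun θ => ?_
  simp

/-- Differentiation under the integral sign of a weighted integral over the centres. -/
lemma hasDerivAt_integral_mul_circleRadon (f : SchwartzMap (ℝ × ℝ) ℂ) {w : ℝ → ℂ}
    (hw : Continuous w) (a b r : ℝ) :
    HasDerivAt (fun r => ∫ x in a..b, w x * circleRadon f x r)
      (∫ x in a..b, w x * circleDerivAverage f (fun θ => (Real.cos θ, Real.sin θ)) x r) r := by
  obtain ⟨K, hK⟩ := exists_lipschitzWith_fderiv_schwartz f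
  have hg (r : ℝ) : Continuous fun x => circleRadon f x r :=
    (continuous_circleRadon f).comp (Continuous.prodMk_left r)
  have hg' : Continuous fun x =>
      circleDerivAverage f (fun θ => (Real.cos θ, Real.sin θ)) x r :=
    (continuous_circleDerivAverage f (by fun_prop)).comp (Continuous.prodMk_left r)
  refine (intervalIntegral.hasDerivAt_integral_of_dominated_loc_of_deriv_le
    (s := Metric.ball r 1)
    (F' := fun r x => w x * circleDerivAverage f (fun θ => (Real.cos θ, Real.sin θ)) x r)
    (bound := fun x => ‖w x‖ * (K * (|r| + 1))) (Metric.ball_mem_nhds r one_pos)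
    (Eventually.of_forall fun t => (hw.mul (hg t)).aestronglyMeasurable)
    ((hw.mul (hg r)).intervalIntegrable _ _) (hw.mul hg').aestronglyMeasurable ?_
    (Continuous.intervalIntegrable (by fun_prop) _ _) ?_).2
  · refine Eventually.of_forall fun x _ t ht => ?_
    rw [norm_mul]
    gcongr
    refine (norm_circleDerivAverage_radius_le f hK x t).trans ?_
    gcongr
    rw [Metric.mem_ball, Real.dist_eq] at ht
    linarith [abs_sub_abs_le_abs_sub t r]
  · exact Eventually.of_forall fun x _ t _ => (hasDerivAt_circleRadon_radius f x t).const_mul _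

lemma exists_norm_deriv_integral_mul_circleRadon_le (f : SchwartzMap (ℝ × ℝ) ℂ) {w : ℝ → ℂ}
    (hw : Continuous w) (a b : ℝ) :
    ∃ C, ∀ r, ‖deriv (fun r => ∫ x in a..b, w x * circleRadon f x r) r‖ ≤ C * |r| := by
  obtain ⟨K, hK⟩ := exists_lipschitzWith_fderiv_schwartz f
  obtain ⟨M, hM⟩ := (isCompact_uIcc (a := a) (b := b)).exists_bound_of_continuousOn hw.continuousOn
  refine ⟨M * K * |b - a|, fun r => ?_⟩
  rw [(hasDerivAt_integral_mul_circleRadon f hw a b r).deriv]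
  refine (intervalIntegral.norm_integral_le_of_norm_le_const (C := M * (K * |r|))
    fun x hx => ?_).trans_eq (by ring)
  have hwx := hM x (Set.uIoc_subset_uIcc hx)
  rw [norm_mul]
  exact mul_le_mul hwx (norm_circleDerivAverage_radius_le f hK x r) (norm_nonneg _)
    ((norm_nonneg _).trans hwx)

/-- **Recovery of even data from its projections onto the family `i_even^{k,l}`.**
Let `g = Rf` be even in `x`. With coefficients
`c_{k,l} = (ε_k ε_l/(LR)) ∫_0^R ∫_0^L cos(kπ√(L²-x'²)/L)·cos(lπ√(R²-r'²)/R)·x'·r'·g(x',r') dx' dr'`,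
for `0 < x < L`, `0 < r < R` the iterated double series
`Σ_k Σ_l c_{k,l}·cos(kπ√(L²-x²)/L)·cos(lπ√(R²-r²)/R)/(√(L²-x²)·√(R²-r²))`
converges (inner sums in `l` converge, and the series of inner sums converges) to `g(x,r)`. -/
theorem stmt13 (L R : ℝ) (hL : 0 < L) (hR : 0 < R)
    (f : SchwartzMap (ℝ × ℝ) ℂ)
    (hsym : ∀ x r : ℝ, circleRadon (fun p => f p) (-x) r = circleRadon (fun p => f p) x r)
    (c : ℕ → ℕ → ℂ)
    (hc : ∀ k l : ℕ, c k l =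
      ((neumannEps k * neumannEps l / (L * R) : ℝ) : ℂ) *
        ∫ r' in (0 : ℝ)..R, ∫ x' in (0 : ℝ)..L,
          ((Real.cos ((k * π / L) * Real.sqrt (L ^ 2 - x' ^ 2)) *
              Real.cos ((l * π / R) * Real.sqrt (R ^ 2 - r' ^ 2)) * x' * r' : ℝ) : ℂ) *
            circleRadon (fun p => f p) x' r') :
    ∀ x r : ℝ, 0 < x → x < L → 0 < r → r < R →
      ∃ S : ℕ → ℂ,
        (∀ k : ℕ, HasSum
          (fun l : ℕ => c k l *
            ((Real.cos ((k * π / L) * Real.sqrt (L ^ 2 - x ^ 2)) *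
                Real.cos ((l * π / R) * Real.sqrt (R ^ 2 - r ^ 2)) /
                (Real.sqrt (L ^ 2 - x ^ 2) * Real.sqrt (R ^ 2 - r ^ 2)) : ℝ) : ℂ))
          (S k)) ∧
        HasSum S (circleRadon (fun p => f p) x r) := by
  intro x r hx hxL hr hrR
  obtain ⟨K, hK⟩ := exists_lipschitzWith_fderiv_schwartz f
  let w (k : ℕ) (t : ℝ) : ℂ := (Real.cos (k * π / L * √(L ^ 2 - t ^ 2)) : ℂ) * t
  have hw (k : ℕ) : Continuous (w k) := by fun_prop
  let g (k : ℕ) (r : ℝ) : ℂ := ∫ t in (0 : ℝ)..L, w k t * circleRadon f t r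
  refine ⟨fun k => ((neumannEps k / L : ℝ) : ℂ) * g k r *
    ((Real.cos (k * π / L * √(L ^ 2 - x ^ 2)) / √(L ^ 2 - x ^ 2) : ℝ) : ℂ), fun k => ?_, ?_⟩
  · obtain ⟨C, hC⟩ := exists_norm_deriv_integral_mul_circleRadon_le f (hw k) 0 L
    have key := (hasSum_cos_sqrt hR (h := g k)
      (fun t => (hasDerivAt_integral_mul_circleRadon f (hw k) 0 L t).differentiableAt)
      hC hr hrR).mul_left (((neumannEps k / L : ℝ) : ℂ) *
        ((Real.cos (k * π / L * √(L ^ 2 - x ^ 2)) / √(L ^ 2 - x ^ 2) : ℝ) : ℂ))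
    convert! key using 1
    · funext l
      have hint : (∫ r' in (0 : ℝ)..R, ∫ x' in (0 : ℝ)..L,
          ((Real.cos ((k * π / L) * √(L ^ 2 - x' ^ 2)) *
              Real.cos ((l * π / R) * √(R ^ 2 - r' ^ 2)) * x' * r' : ℝ) : ℂ) *
            circleRadon (fun p => f p) x' r') =
          ∫ t in (0 : ℝ)..R, (Real.cos (l * π / R * √(R ^ 2 - t ^ 2)) : ℂ) * (t * g k t) := by
        congr 1
        funext t
        rw [← intervalIntegral.integral_const_mul, ← intervalIntegral.integral_const_mul]
        congr 1
        funext s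
        simp only [w]
        push_cast
        ring
      rw [hc, hint]
      push_cast
      ring
    · ring
  · have key := hasSum_cos_sqrt hL (h := fun x => circleRadon f x r)
      (fun t => (hasDerivAt_circleRadon_center f t r).differentiableAt)
      (fun t => by
        rw [(hasDerivAt_circleRadon_center f t r).deriv]
        exact norm_circleDerivAverage_center_le f hK (fun x => hsym x r) t) hx hxL
    convert! key using 1
    funext k
    simp only [g, w, mul_assoc]
end
end

section
/- Let f be a Schwartz function on ℝ², let g = Rf, and let R > 0. Then for every x ∈ ℝ and every r > R, the inner integral ∫_0^∞ cos(bs)·s·g(x, √(s²+R²)) ds converges absolutely for each b ≥ 0, the resulting function of b is integrable on (0,∞), and g(x,r) = (2/π)·(r²−R²)^{−1/2} ∫_0^∞ cos(b√(r²−R²)) · (∫_0^∞ cos(bs)·s·g(x, √(s²+R²)) ds) db. (This says the data g for radii r > R is completely recoverable from its projections onto the orthogonal family o_range^{a,b}.) -/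
open MeasureTheory Metric Real Filter

noncomputable section

/-- The integral of an even function over the line is twice its integral over the half-line. -/
theorem integral_eq_two_mul_integral_Ioi_of_even {F : ℝ → ℂ} (hF : Integrable F)
    (heven : ∀ s, F (-s) = F s) : ∫ s, F s = 2 * ∫ s in Set.Ioi (0 : ℝ), F s := by
  rw [← intervalIntegral.integral_Iic_add_Ioi (b := 0) hF.integrableOn hF.integrableOn]
  have h : ∫ s in Set.Iic (0 : ℝ), F s = ∫ s in Set.Ioi (0 : ℝ), F s := by
    have := integral_comp_neg_Iic (0 : ℝ) F
    simpa [heven] using this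
  rw [h]
  ring

theorem integrable_exp_mul {F : ℝ → ℂ} (hF : Integrable F) (b : ℝ) :
    Integrable fun s : ℝ => Complex.exp ((b * s : ℝ) * Complex.I) * F s := by
  refine hF.bdd_mul (c := 1) (by fun_prop) (Eventually.of_forall fun s => ?_)
  rw [Complex.norm_exp_ofReal_mul_I]

theorem integrable_cos_mul {F : ℝ → ℂ} (hF : Integrable F) (b : ℝ) :
    Integrable fun s : ℝ => ((Real.cos (b * s) : ℝ) : ℂ) * F s := by
  refine hF.bdd_mul (c := 1) (by fun_prop) (Eventually.of_forall fun s => ?_)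
  rw [Complex.norm_real]
  exact abs_cos_le_one _

/-- The Fourier integral of an even function is twice its cosine transform. -/
theorem integral_exp_mul_of_even {F : ℝ → ℂ} (hF : Integrable F)
    (heven : ∀ s, F (-s) = F s) (b : ℝ) :
    ∫ s, Complex.exp ((b * s : ℝ) * Complex.I) * F s =
      2 * ∫ s in Set.Ioi (0 : ℝ), ((Real.cos (b * s) : ℝ) : ℂ) * F s := by
  rw [← integral_eq_two_mul_integral_Ioi_of_even (integrable_cos_mul hF b)
    (fun s => by rw [heven, mul_neg, Real.cos_neg])]
  have hneg : ∫ s, Complex.exp ((b * s : ℝ) * Complex.I) * F s =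
      ∫ s, Complex.exp (((-b) * s : ℝ) * Complex.I) * F s := by
    rw [← integral_neg_eq_self]
    simp [heven]
  have hsum : (2 : ℂ) * ∫ s, Complex.exp ((b * s : ℝ) * Complex.I) * F s =
      2 * ∫ s, ((Real.cos (b * s) : ℝ) : ℂ) * F s := by
    rw [two_mul]
    nth_rewrite 2 [hneg]
    rw [← integral_add (integrable_exp_mul hF b) (integrable_exp_mul hF (-b)),
      ← integral_const_mul]
    congr 1
    ext s
    rw [Complex.ofReal_cos, ← mul_assoc, Complex.two_cos, ← add_mul]
    push_cast
    simp only [neg_mul]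
  exact mul_left_cancel₀ two_ne_zero hsum

open scoped FourierTransform in
theorem fourier_eq_two_mul_cosine {H : ℝ → ℂ} (hH : Integrable H)
    (heven : ∀ s, H (-s) = H s) (ξ : ℝ) :
    𝓕 H ξ = 2 * ∫ s in Set.Ioi (0 : ℝ), ((Real.cos (2 * π * ξ * s) : ℝ) : ℂ) * H s := by
  have h := integral_exp_mul_of_even hH heven (-(2 * π * ξ))
  rw [Real.fourier_real_eq_integral_exp_smul]
  simp only [neg_mul, Real.cos_neg, smul_eq_mul] at h ⊢
  rw [← h]
  congr 1
  ext s
  ring_nf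

/-- Continuity of the cosine transform of an integrable function. -/
theorem continuous_cosine_transform {H : ℝ → ℂ} (hH : Integrable H) :
    Continuous fun b : ℝ => ∫ s in Set.Ioi (0 : ℝ), ((Real.cos (b * s) : ℝ) : ℂ) * H s := by
  refine continuous_of_dominated (bound := fun s => ‖H s‖)
    (fun b => (integrable_cos_mul hH b).integrableOn.aestronglyMeasurable)
    (fun b => Eventually.of_forall fun s => ?_) hH.norm.integrableOn
    (Eventually.of_forall fun s => by fun_prop)
  rw [norm_mul, Complex.norm_real]
  exact mul_le_of_le_one_left (norm_nonneg _) (abs_cos_le_one _)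

open scoped FourierTransform in
/-- Inversion of the cosine transform. -/
theorem cosine_inversion {H : ℝ → ℂ} (hH : Integrable H) (hcont : Continuous H)
    (heven : ∀ s, H (-s) = H s)
    (hC : Integrable fun b : ℝ =>
      ∫ s in Set.Ioi (0 : ℝ), ((Real.cos (b * s) : ℝ) : ℂ) * H s) (t : ℝ) :
    H t = ((2 / π : ℝ) : ℂ) * ∫ b in Set.Ioi (0 : ℝ), ((Real.cos (b * t) : ℝ) : ℂ) *
      ∫ s in Set.Ioi (0 : ℝ), ((Real.cos (b * s) : ℝ) : ℂ) * H s := by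
  set C : ℝ → ℂ := fun b => ∫ s in Set.Ioi (0 : ℝ), ((Real.cos (b * s) : ℝ) : ℂ) * H s with hCdef
  have hFC : 𝓕 H = fun ξ => 2 * C (2 * π * ξ) := by
    ext ξ
    exact fourier_eq_two_mul_cosine hH heven ξ
  have hint : Integrable (𝓕 H) := by
    rw [hFC]
    exact (hC.comp_mul_left' (by positivity)).const_mul 2
  have hevenF : ∀ ξ, 𝓕 H (-ξ) = 𝓕 H ξ := by
    intro ξ
    simp [hFC, hCdef]
  have hinv : 𝓕⁻ (𝓕 H) t = H t := hH.fourierInv_fourier_eq hint hcont.continuousAt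
  have hexp := integral_exp_mul_of_even hint hevenF (2 * π * t)
  have hF : 𝓕⁻ (𝓕 H) t = ∫ s, Complex.exp ((2 * π * t * s : ℝ) * Complex.I) * 𝓕 H s := by
    rw [Real.fourierInv_eq']
    congr 1
    ext s
    simp only [RCLike.inner_apply, conj_trivial, smul_eq_mul]
    ring_nf
  rw [← hinv, hF, hexp, hFC]
  have hscale := integral_comp_mul_left_Ioi
    (fun b => ((Real.cos (b * t) : ℝ) : ℂ) * C b) 0 (b := 2 * π) (by positivity)
  rw [mul_zero] at hscale
  have h2 : ∫ s in Set.Ioi (0 : ℝ), ((Real.cos (2 * π * t * s) : ℝ) : ℂ) * (2 * C (2 * π * s)) =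
      2 * ∫ s in Set.Ioi (0 : ℝ), ((Real.cos (2 * π * s * t) : ℝ) : ℂ) * C (2 * π * s) := by
    rw [← integral_const_mul]
    congr 1
    ext s
    rw [show 2 * π * t * s = 2 * π * s * t by ring]
    ring
  rw [h2, hscale, Complex.real_smul]
  have hπ : (π : ℂ) ≠ 0 := by exact_mod_cast pi_ne_zero
  generalize ∫ b in Set.Ioi (0 : ℝ), ((Real.cos (b * t) : ℝ) : ℂ) * C b = J
  push_cast
  field_simp

theorem hasDerivAt_sqrt_sq_add_sq_s15 {R : ℝ} (hR : 0 < R) (s : ℝ) :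
    HasDerivAt (fun s : ℝ => √(s ^ 2 + R ^ 2)) (s / √(s ^ 2 + R ^ 2)) s := by
  refine (((hasDerivAt_pow 2 s).add_const (R ^ 2)).sqrt (by positivity)).congr_deriv ?_
  rw [Nat.cast_ofNat, pow_one, mul_div_mul_left _ _ two_ne_zero]

theorem abs_le_sqrt_sq_add_sq (s R : ℝ) : |s| ≤ √(s ^ 2 + R ^ 2) :=
  abs_le_sqrt (by nlinarith [sq_nonneg R])

theorem div_one_add_cube_le {M s p : ℝ} (hM : 0 ≤ M) (hs : |s| ≤ p) :
    (1 + p) * (M / (1 + |p|) ^ 3) ≤ M * (1 + s ^ 2)⁻¹ := by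
  have hp : 0 ≤ p := (abs_nonneg s).trans hs
  have hsq : s ^ 2 ≤ p ^ 2 := sq_le_sq' (neg_le_of_abs_le hs) ((le_abs_self s).trans hs)
  rw [abs_of_nonneg hp]
  have h : (1 + p) * (M / (1 + p) ^ 3) = M * ((1 + p) ^ 2)⁻¹ := by field_simp
  rw [h]
  gcongr
  nlinarith

theorem tendsto_mul_inv_one_add_sq (M : ℝ) :
    Tendsto (fun s : ℝ => M * (1 + s ^ 2)⁻¹) atTop (nhds 0) := by
  have : Tendsto (fun s : ℝ => (1 + s ^ 2)⁻¹) atTop (nhds 0) :=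
    tendsto_inv_atTop_zero.comp
      (tendsto_atTop_add_const_left _ _ (tendsto_pow_atTop two_ne_zero))
  simpa using this.const_mul M

theorem norm_cos_mul_le (a : ℝ) (z : ℂ) : ‖((Real.cos a : ℝ) : ℂ) * z‖ ≤ ‖z‖ := by
  rw [norm_mul, Complex.norm_real]
  exact mul_le_of_le_one_left (norm_nonneg _) (abs_cos_le_one _)

theorem norm_sin_mul_le (a : ℝ) (z : ℂ) : ‖((Real.sin a : ℝ) : ℂ) * z‖ ≤ ‖z‖ := by
  rw [norm_mul, Complex.norm_real]
  exact mul_le_of_le_one_left (norm_nonneg _) (abs_sin_le_one _)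

theorem norm_setIntegral_cos_mul_le {k : ℝ → ℂ} {M : ℝ} (hM : 0 ≤ M)
    (hk : ∀ s, ‖k s‖ ≤ M * (1 + s ^ 2)⁻¹) (b : ℝ) :
    ‖∫ s in Set.Ioi (0 : ℝ), ((Real.cos (b * s) : ℝ) : ℂ) * k s‖ ≤ M * π := by
  calc _ ≤ ∫ s in Set.Ioi (0 : ℝ), M * (1 + s ^ 2)⁻¹ :=
        norm_integral_le_of_norm_le (integrable_inv_one_add_sq.const_mul M).integrableOn
          (Eventually.of_forall fun s => (norm_cos_mul_le _ _).trans (hk s))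
    _ ≤ ∫ s, M * (1 + s ^ 2)⁻¹ :=
        setIntegral_le_integral (integrable_inv_one_add_sq.const_mul M)
          (Eventually.of_forall fun s => by positivity)
    _ = M * π := by rw [integral_const_mul, integral_univ_inv_one_add_sq]

/-- Two integrations by parts in the cosine transform over the half-line: the only boundary
term comes from the first derivative at `0`. -/
theorem sq_mul_cosine_transform {k k' k'' : ℝ → ℂ} {M : ℝ}
    (hk : ∀ s, HasDerivAt k (k' s) s) (hk' : ∀ s, HasDerivAt k' (k'' s) s)
    (hk''c : Continuous k'')
    (bk : ∀ s, ‖k s‖ ≤ M * (1 + s ^ 2)⁻¹) (bk' : ∀ s, ‖k' s‖ ≤ M * (1 + s ^ 2)⁻¹)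
    (bk'' : ∀ s, ‖k'' s‖ ≤ M * (1 + s ^ 2)⁻¹) (b : ℝ) :
    (b : ℂ) ^ 2 * ∫ s in Set.Ioi (0 : ℝ), ((Real.cos (b * s) : ℝ) : ℂ) * k s =
      -k' 0 - ∫ s in Set.Ioi (0 : ℝ), ((Real.cos (b * s) : ℝ) : ℂ) * k'' s := by
  have hint : ∀ F : ℝ → ℂ, Continuous F → (∀ s, ‖F s‖ ≤ M * (1 + s ^ 2)⁻¹) → Integrable F :=
    fun F hF hb => (integrable_inv_one_add_sq.const_mul M).mono' hF.aestronglyMeasurable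
      (Eventually.of_forall hb)
  have hkc : Continuous k := continuous_iff_continuousAt.2 fun s => (hk s).continuousAt
  have i1 := ((integrable_cos_mul (hint k hkc bk) b).const_mul ((b : ℂ) ^ 2)).integrableOn
    (s := Set.Ioi 0)
  have i2 := (integrable_cos_mul (hint k'' hk''c bk'') b).integrableOn (s := Set.Ioi 0)
  have hcos : ∀ s : ℝ, HasDerivAt (fun s : ℝ => ((Real.cos (b * s) : ℝ) : ℂ))
      ((-(b * Real.sin (b * s)) : ℝ) : ℂ) s := fun s => by
    refine ((hasDerivAt_const_mul b).cos.ofReal_comp).congr_deriv ?_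
    push_cast
    ring
  have hsin : ∀ s : ℝ, HasDerivAt (fun s : ℝ => ((Real.sin (b * s) : ℝ) : ℂ))
      ((b * Real.cos (b * s) : ℝ) : ℂ) s := fun s => by
    refine ((hasDerivAt_const_mul b).sin.ofReal_comp).congr_deriv ?_
    push_cast
    ring
  have hW : ∀ s ∈ Set.Ici (0 : ℝ), HasDerivAt
      (fun s : ℝ => (b : ℂ) * (((Real.sin (b * s) : ℝ) : ℂ) * k s)
        + ((Real.cos (b * s) : ℝ) : ℂ) * k' s)
      ((b : ℂ) ^ 2 * (((Real.cos (b * s) : ℝ) : ℂ) * k s)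
        + ((Real.cos (b * s) : ℝ) : ℂ) * k'' s) s := fun s _ => by
    refine ((((hsin s).mul (hk s)).const_mul (b : ℂ)).add
      ((hcos s).mul (hk' s))).congr_deriv ?_
    push_cast
    ring
  have hlim : Tendsto (fun s : ℝ => (b : ℂ) * (((Real.sin (b * s) : ℝ) : ℂ) * k s)
        + ((Real.cos (b * s) : ℝ) : ℂ) * k' s) atTop (nhds 0) := by
    have h1 : Tendsto (fun s : ℝ => ((Real.sin (b * s) : ℝ) : ℂ) * k s) atTop (nhds 0) :=
      squeeze_zero_norm (fun s => (norm_sin_mul_le _ _).trans (bk s))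
        (tendsto_mul_inv_one_add_sq M)
    have h2 : Tendsto (fun s : ℝ => ((Real.cos (b * s) : ℝ) : ℂ) * k' s) atTop (nhds 0) :=
      squeeze_zero_norm (fun s => (norm_cos_mul_le _ _).trans (bk' s))
        (tendsto_mul_inv_one_add_sq M)
    simpa using (h1.const_mul (b : ℂ)).add h2
  have h := integral_Ioi_of_hasDerivAt_of_tendsto' hW (i1.add i2) hlim
  rw [integral_add i1 i2, integral_const_mul] at h
  simp only [mul_zero, Real.sin_zero, Real.cos_zero, Complex.ofReal_zero, Complex.ofReal_one,
    zero_mul, one_mul, zero_add, zero_sub] at h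
  rw [← h]
  ring

/-- The cosine transform of a `C²` function decays quadratically. -/
theorem norm_cosine_transform_le {k k' k'' : ℝ → ℂ} {M : ℝ} (hM : 0 ≤ M)
    (hk : ∀ s, HasDerivAt k (k' s) s) (hk' : ∀ s, HasDerivAt k' (k'' s) s)
    (hk''c : Continuous k'')
    (bk : ∀ s, ‖k s‖ ≤ M * (1 + s ^ 2)⁻¹) (bk' : ∀ s, ‖k' s‖ ≤ M * (1 + s ^ 2)⁻¹)
    (bk'' : ∀ s, ‖k'' s‖ ≤ M * (1 + s ^ 2)⁻¹) (b : ℝ) :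
    ‖∫ s in Set.Ioi (0 : ℝ), ((Real.cos (b * s) : ℝ) : ℂ) * k s‖ ≤
      (M * π + (M + M * π)) * (1 + b ^ 2)⁻¹ := by
  have h0 := norm_setIntegral_cos_mul_le hM bk b
  have h2 := norm_setIntegral_cos_mul_le hM bk'' b
  have h1 : ‖k' 0‖ ≤ M := by simpa using bk' 0
  have heq := congrArg norm (sq_mul_cosine_transform hk hk' hk''c bk bk' bk'' b)
  rw [norm_mul, norm_pow, Complex.norm_real, Real.norm_eq_abs, sq_abs] at heq
  have h3 := norm_sub_le (-k' 0) (∫ s in Set.Ioi (0 : ℝ), ((Real.cos (b * s) : ℝ) : ℂ) * k'' s)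
  rw [norm_neg, ← heq] at h3
  rw [← div_eq_mul_inv, le_div_iff₀ (by positivity)]
  linarith

/-- The radial profile `s q(√(s² + R²))` of a decaying `C²` function `q` has a quadratically
decaying cosine transform. -/
theorem exists_profile_decay {q q' q'' : ℝ → ℂ} {R M : ℝ} (hR : 0 < R) (hM : 0 ≤ M)
    (hq : ∀ t, HasDerivAt q (q' t) t) (hq' : ∀ t, HasDerivAt q' (q'' t) t)
    (hq''c : Continuous q'')
    (bq : ∀ t, ‖q t‖ ≤ M / (1 + |t|) ^ 3) (bq' : ∀ t, ‖q' t‖ ≤ M / (1 + |t|) ^ 3)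
    (bq'' : ∀ t, ‖q'' t‖ ≤ M / (1 + |t|) ^ 3) :
    (∀ s : ℝ, ‖(s : ℂ) * q √(s ^ 2 + R ^ 2)‖ ≤ 3 * M * (1 + s ^ 2)⁻¹) ∧
    ∃ K : ℝ, ∀ b : ℝ,
      ‖∫ s in Set.Ioi (0 : ℝ), ((Real.cos (b * s) : ℝ) : ℂ) * ((s : ℂ) * q √(s ^ 2 + R ^ 2))‖ ≤
        K * (1 + b ^ 2)⁻¹ := by
  set p : ℝ → ℝ := fun s => √(s ^ 2 + R ^ 2) with hp
  have hppos : ∀ s, 0 < p s := fun s => by simp only [hp]; positivity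
  have hsp : ∀ s, |s| ≤ p s := fun s => abs_le_sqrt_sq_add_sq s R
  have hdp : ∀ s, HasDerivAt p (s / p s) s := hasDerivAt_sqrt_sq_add_sq_s15 hR
  have hpc : Continuous p := by simp only [hp]; fun_prop
  have hpne : ∀ s, p s ≠ 0 := fun s => (hppos s).ne'
  have hratio : ∀ s, |s / p s| ≤ 1 := fun s => by
    rw [abs_div, abs_of_pos (hppos s)]
    exact div_le_one_of_le₀ (hsp s) (hppos s).le
  have hcomp : ∀ {u u' : ℝ → ℂ}, (∀ t, HasDerivAt u (u' t) t) → ∀ s,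
      HasDerivAt (fun s => u (p s)) (((s / p s : ℝ) : ℂ) * u' (p s)) s := fun hu s => by
    refine ((hu (p s)).scomp s (hdp s)).congr_deriv ?_
    rw [Complex.real_smul]
  have hid : ∀ s : ℝ, HasDerivAt (fun s : ℝ => (s : ℂ)) 1 s := fun s => by
    simpa using (hasDerivAt_id s).ofReal_comp
  have hk : ∀ s : ℝ, HasDerivAt (fun s : ℝ => (s : ℂ) * q (p s))
      (q (p s) + ((s * (s / p s) : ℝ) : ℂ) * q' (p s)) s := fun s => by
    refine ((hid s).mul (hcomp hq s)).congr_deriv ?_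
    push_cast
    ring
  have hw : ∀ s : ℝ, HasDerivAt (fun s : ℝ => s * (s / p s))
      (s / p s * (2 - (s / p s) ^ 2)) s := fun s => by
    refine ((hasDerivAt_id s).mul ((hasDerivAt_id s).div (hdp s) (hpne s))).congr_deriv ?_
    have := hpne s
    simp only [id, Pi.div_apply]
    field_simp
    ring
  have hk' : ∀ s : ℝ, HasDerivAt (fun s : ℝ => q (p s) + ((s * (s / p s) : ℝ) : ℂ) * q' (p s))
      (((s / p s * (3 - (s / p s) ^ 2) : ℝ) : ℂ) * q' (p s) +
        ((s * (s / p s) * (s / p s) : ℝ) : ℂ) * q'' (p s)) s := fun s => by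
    refine ((hcomp hq s).add ((hw s).ofReal_comp.mul (hcomp hq' s))).congr_deriv ?_
    push_cast
    ring
  have hq'c : Continuous q' := continuous_iff_continuousAt.2 fun s => (hq' s).continuousAt
  have hrc : Continuous fun s => s / p s := continuous_id.div hpc hpne
  have hk''c : Continuous fun s : ℝ =>
      ((s / p s * (3 - (s / p s) ^ 2) : ℝ) : ℂ) * q' (p s) +
        ((s * (s / p s) * (s / p s) : ℝ) : ℂ) * q'' (p s) := by
    fun_prop
  have hD : ∀ s, 0 ≤ M / (1 + |p s|) ^ 3 := fun s => by positivity
  have hkey : ∀ s, 3 * ((1 + p s) * (M / (1 + |p s|) ^ 3)) ≤ 3 * M * (1 + s ^ 2)⁻¹ := fun s => by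
    have := div_one_add_cube_le hM (hsp s)
    linarith
  have hweight : ∀ s, |s * (s / p s)| ≤ p s := fun s => by
    rw [abs_mul]
    exact (mul_le_of_le_one_right (abs_nonneg _) (hratio s)).trans (hsp s)
  have hweight' : ∀ s, |s * (s / p s) * (s / p s)| ≤ p s := fun s => by
    rw [abs_mul]
    exact (mul_le_of_le_one_right (abs_nonneg _) (hratio s)).trans (hweight s)
  have hweight'' : ∀ s, |s / p s * (3 - (s / p s) ^ 2)| ≤ 3 := fun s => by
    have h := hratio s
    have hsq : (s / p s) ^ 2 ≤ 1 := (sq_le_one_iff_abs_le_one _).2 h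
    rw [abs_mul]
    have h3 : |3 - (s / p s) ^ 2| ≤ 3 := abs_le.2 ⟨by linarith, by linarith [sq_nonneg (s / p s)]⟩
    calc _ ≤ 1 * 3 := mul_le_mul h h3 (abs_nonneg _) zero_le_one
      _ = 3 := one_mul 3
  have hmul : ∀ {a c d : ℝ} {z : ℂ}, |a| ≤ c → ‖z‖ ≤ d → ‖(a : ℂ) * z‖ ≤ c * d :=
    fun ha hz => by
      rw [norm_mul, Complex.norm_real]
      exact mul_le_mul ha hz (norm_nonneg _) ((abs_nonneg _).trans ha)
  have bk : ∀ s : ℝ, ‖(s : ℂ) * q (p s)‖ ≤ 3 * M * (1 + s ^ 2)⁻¹ := fun s => by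
    have h1 := hmul (hsp s) (bq (p s))
    have h2 := mul_nonneg (hppos s).le (hD s)
    linarith [hkey s, hD s]
  have bk' : ∀ s : ℝ, ‖q (p s) + ((s * (s / p s) : ℝ) : ℂ) * q' (p s)‖ ≤
      3 * M * (1 + s ^ 2)⁻¹ := fun s => by
    have h1 := hmul (hweight s) (bq' (p s))
    have h2 := mul_nonneg (hppos s).le (hD s)
    have h3 := norm_add_le (q (p s)) (((s * (s / p s) : ℝ) : ℂ) * q' (p s))
    linarith [hkey s, hD s, bq (p s)]
  have bk'' : ∀ s : ℝ, ‖((s / p s * (3 - (s / p s) ^ 2) : ℝ) : ℂ) * q' (p s) +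
        ((s * (s / p s) * (s / p s) : ℝ) : ℂ) * q'' (p s)‖ ≤ 3 * M * (1 + s ^ 2)⁻¹ := fun s => by
    have h1 := hmul (hweight' s) (bq'' (p s))
    have h2 := mul_nonneg (hppos s).le (hD s)
    have h3 := norm_add_le (((s / p s * (3 - (s / p s) ^ 2) : ℝ) : ℂ) * q' (p s))
      (((s * (s / p s) * (s / p s) : ℝ) : ℂ) * q'' (p s))
    have h4 := hmul (hweight'' s) (bq' (p s))
    linarith [hkey s, hD s]
  exact ⟨bk, _, norm_cosine_transform_le (by positivity) hk hk' hk''c bk bk' bk''⟩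

/-- Integral of `f` over the circle of radius `t` centred at `(x, 0)` against an angular weight. -/
def weightedCircleIntegral (w : ℝ → ℝ) (f : ℝ × ℝ → ℂ) (x t : ℝ) : ℂ :=
  ∫ θ in (0 : ℝ)..(2 * π), (w θ : ℂ) * f (x + t * Real.cos θ, t * Real.sin θ)

theorem one_add_abs_le_circle_point (x t θ : ℝ) :
    1 + |t| ≤ (2 + |x|) * (1 + ‖((x + t * Real.cos θ, t * Real.sin θ) : ℝ × ℝ)‖) := by
  set P : ℝ × ℝ := (x + t * Real.cos θ, t * Real.sin θ) with hP
  have h1 : |x + t * Real.cos θ| ≤ ‖P‖ := norm_fst_le P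
  have h2 : |t * Real.sin θ| ≤ ‖P‖ := norm_snd_le P
  have h3 : |t * Real.cos θ| ≤ ‖P‖ + |x| := by
    have := abs_sub (x + t * Real.cos θ) x
    rw [add_sub_cancel_left] at this
    linarith
  have h4 : |t| ≤ |t * Real.cos θ| + |t * Real.sin θ| := by
    rw [abs_mul, abs_mul, ← mul_add]
    refine le_mul_of_one_le_right (abs_nonneg _) ?_
    nlinarith [Real.sin_sq_add_cos_sq θ, sq_abs (Real.cos θ), sq_abs (Real.sin θ),
      abs_nonneg (Real.cos θ), abs_nonneg (Real.sin θ), abs_cos_le_one θ, abs_sin_le_one θ]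
  nlinarith [norm_nonneg P, abs_nonneg x, mul_nonneg (abs_nonneg x) (norm_nonneg P)]

theorem exists_schwartz_circle_decay (f : SchwartzMap (ℝ × ℝ) ℂ) (x : ℝ) :
    ∃ M : ℝ, 0 ≤ M ∧ ∀ t θ : ℝ,
      ‖f (x + t * Real.cos θ, t * Real.sin θ)‖ ≤ M / (1 + |t|) ^ 3 := by
  set S : ℝ := 2 ^ 3 * (Finset.Iic ((3, 0) : ℕ × ℕ)).sup
    (fun m => SchwartzMap.seminorm ℝ m.1 m.2) f with hS
  have hb : ∀ P, (1 + ‖P‖) ^ 3 * ‖f P‖ ≤ S := fun P => by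
    have := SchwartzMap.one_add_le_sup_seminorm_apply (𝕜 := ℝ) (m := (3, 0)) le_rfl le_rfl f P
    rwa [norm_iteratedFDeriv_zero] at this
  have hS0 : 0 ≤ S := (by positivity : (0 : ℝ) ≤ (1 + ‖(0 : ℝ × ℝ)‖) ^ 3 * ‖f 0‖).trans (hb 0)
  refine ⟨(2 + |x|) ^ 3 * S, by positivity, fun t θ => ?_⟩
  rw [le_div_iff₀ (by positivity)]
  have h := hb (x + t * Real.cos θ, t * Real.sin θ)
  have h3 := pow_le_pow_left₀ (by positivity) (one_add_abs_le_circle_point x t θ) 3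
  calc _ ≤ ‖f (x + t * Real.cos θ, t * Real.sin θ)‖ *
        ((2 + |x|) * (1 + ‖((x + t * Real.cos θ, t * Real.sin θ) : ℝ × ℝ)‖)) ^ 3 := by gcongr
    _ = (2 + |x|) ^ 3 * ((1 + ‖((x + t * Real.cos θ, t * Real.sin θ) : ℝ × ℝ)‖) ^ 3 *
        ‖f (x + t * Real.cos θ, t * Real.sin θ)‖) := by ring
    _ ≤ _ := by gcongr

theorem exists_weightedCircleIntegral_decay {w : ℝ → ℝ} (hw : ∀ θ, |w θ| ≤ 1)
    (f : SchwartzMap (ℝ × ℝ) ℂ) (x : ℝ) :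
    ∃ M : ℝ, 0 ≤ M ∧ ∀ t : ℝ, ‖weightedCircleIntegral w f x t‖ ≤ M / (1 + |t|) ^ 3 := by
  obtain ⟨M, hM, h⟩ := exists_schwartz_circle_decay f x
  refine ⟨M * (2 * π), by positivity, fun t => ?_⟩
  refine (intervalIntegral.norm_integral_le_of_norm_le_const (C := M / (1 + |t|) ^ 3)
    fun θ _ => ?_).trans_eq ?_
  · rw [norm_mul, Complex.norm_real]
    exact (mul_le_of_le_one_left (norm_nonneg _) (hw θ)).trans (h t θ)
  · rw [sub_zero, abs_of_pos two_pi_pos]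
    ring

open scoped LineDeriv in
theorem hasDerivAt_weightedCircleIntegral {w : ℝ → ℝ} (hwc : Continuous w)
    (hw : ∀ θ, |w θ| ≤ 1) (f : SchwartzMap (ℝ × ℝ) ℂ) (x t : ℝ) :
    HasDerivAt (weightedCircleIntegral w f x)
      (weightedCircleIntegral (fun θ => w θ * Real.cos θ)
        (∂_{((1, 0) : ℝ × ℝ)} f : SchwartzMap (ℝ × ℝ) ℂ) x t +
        weightedCircleIntegral (fun θ => w θ * Real.sin θ)
          (∂_{((0, 1) : ℝ × ℝ)} f : SchwartzMap (ℝ × ℝ) ℂ) x t) t := by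
  set f₁ : SchwartzMap (ℝ × ℝ) ℂ := ∂_{((1, 0) : ℝ × ℝ)} f with hf₁
  set f₂ : SchwartzMap (ℝ × ℝ) ℂ := ∂_{((0, 1) : ℝ × ℝ)} f with hf₂
  have hfc := f.continuous
  have hf₁c := f₁.continuous
  have hf₂c := f₂.continuous
  obtain ⟨M₁, hM₁, h₁⟩ := exists_schwartz_circle_decay f₁ x
  obtain ⟨M₂, hM₂, h₂⟩ := exists_schwartz_circle_decay f₂ x
  have hdrop : ∀ {M u : ℝ}, 0 ≤ M → M / (1 + |u|) ^ 3 ≤ M := fun hM =>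
    div_le_self hM (one_le_pow₀ (le_add_of_nonneg_right (abs_nonneg _)))
  have hmul : ∀ {a : ℝ} {z : ℂ}, |a| ≤ 1 → ‖(a : ℂ) * z‖ ≤ ‖z‖ := fun ha => by
    rw [norm_mul, Complex.norm_real]
    exact mul_le_of_le_one_left (norm_nonneg _) ha
  have hprod : ∀ {a c : ℝ}, |a| ≤ 1 → |c| ≤ 1 → |a * c| ≤ 1 := fun ha hc => by
    rw [abs_mul]
    exact mul_le_one₀ ha (abs_nonneg _) hc
  have hderiv : ∀ θ u : ℝ, HasDerivAt
      (fun u : ℝ => (w θ : ℂ) * f (x + u * Real.cos θ, u * Real.sin θ))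
      (((w θ * Real.cos θ : ℝ) : ℂ) * f₁ (x + u * Real.cos θ, u * Real.sin θ) +
        ((w θ * Real.sin θ : ℝ) : ℂ) * f₂ (x + u * Real.cos θ, u * Real.sin θ)) u := by
    intro θ u
    have hγ : HasDerivAt (fun u : ℝ => ((x + u * Real.cos θ, u * Real.sin θ) : ℝ × ℝ))
        (Real.cos θ, Real.sin θ) u :=
      ((hasDerivAt_mul_const _).const_add x).prodMk (hasDerivAt_mul_const _)
    have hf := (f.differentiableAt (x := (x + u * Real.cos θ, u * Real.sin θ))).hasFDerivAt
    refine ((hf.comp_hasDerivAt u hγ).const_mul (w θ : ℂ)).congr_deriv ?_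
    have hdecomp : ((Real.cos θ, Real.sin θ) : ℝ × ℝ) =
        Real.cos θ • ((1, 0) : ℝ × ℝ) + Real.sin θ • ((0, 1) : ℝ × ℝ) := by simp
    rw [hdecomp, map_add, map_smul, map_smul, hf₁, hf₂, SchwartzMap.lineDerivOp_apply_eq_fderiv,
      SchwartzMap.lineDerivOp_apply_eq_fderiv, Complex.real_smul, Complex.real_smul]
    push_cast
    ring
  have key := intervalIntegral.hasDerivAt_integral_of_dominated_loc_of_deriv_le
    (μ := volume) (a := 0) (b := 2 * π) (x₀ := t) (s := Set.univ) (bound := fun _ => M₁ + M₂)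
    (F := fun u θ => (w θ : ℂ) * f (x + u * Real.cos θ, u * Real.sin θ))
    (F' := fun u θ => ((w θ * Real.cos θ : ℝ) : ℂ) * f₁ (x + u * Real.cos θ, u * Real.sin θ) +
        ((w θ * Real.sin θ : ℝ) : ℂ) * f₂ (x + u * Real.cos θ, u * Real.sin θ))
    univ_mem
    (Eventually.of_forall fun u => Continuous.aestronglyMeasurable (by fun_prop))
    (Continuous.intervalIntegrable (by fun_prop) _ _)
    (Continuous.aestronglyMeasurable (by fun_prop))
    (Eventually.of_forall fun θ _ u _ => (norm_add_le _ _).trans (add_le_add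
      ((hmul (hprod (hw θ) (abs_cos_le_one θ))).trans ((h₁ u θ).trans (hdrop hM₁)))
      ((hmul (hprod (hw θ) (abs_sin_le_one θ))).trans ((h₂ u θ).trans (hdrop hM₂)))))
    intervalIntegrable_const
    (Eventually.of_forall fun θ _ u _ => hderiv θ u)
  refine key.2.congr_deriv ?_
  exact intervalIntegral.integral_add (Continuous.intervalIntegrable (by fun_prop) _ _)
    (Continuous.intervalIntegrable (by fun_prop) _ _)

theorem continuous_weightedCircleIntegral {w : ℝ → ℝ} (hwc : Continuous w)
    (hw : ∀ θ, |w θ| ≤ 1) (f : SchwartzMap (ℝ × ℝ) ℂ) (x : ℝ) :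
    Continuous (weightedCircleIntegral w f x) :=
  continuous_iff_continuousAt.2 fun t =>
    (hasDerivAt_weightedCircleIntegral hwc hw f x t).continuousAt

open scoped LineDeriv in
/-- The circular mean of a Schwartz function is a `C²` function of the radius which decays,
together with its first two derivatives. -/
theorem exists_circleRadon_derivatives (f : SchwartzMap (ℝ × ℝ) ℂ) (x : ℝ) :
    ∃ (q' q'' : ℝ → ℂ) (M : ℝ), 0 ≤ M ∧
      (∀ t, HasDerivAt (circleRadon (fun p => f p) x) (q' t) t) ∧
      (∀ t, HasDerivAt q' (q'' t) t) ∧ Continuous q'' ∧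
      (∀ t, ‖circleRadon (fun p => f p) x t‖ ≤ M / (1 + |t|) ^ 3) ∧
      (∀ t, ‖q' t‖ ≤ M / (1 + |t|) ^ 3) ∧ (∀ t, ‖q'' t‖ ≤ M / (1 + |t|) ^ 3) := by
  set c : ℂ := ((1 / (2 * π) : ℝ) : ℂ) with hc
  have hcn : ‖c‖ ≤ 1 := by
    rw [hc, Complex.norm_real, Real.norm_of_nonneg (by positivity)]
    exact div_le_one_of_le₀ (by linarith [pi_gt_three]) (by positivity)
  set f₁ : SchwartzMap (ℝ × ℝ) ℂ := ∂_{((1, 0) : ℝ × ℝ)} f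
  set f₂ : SchwartzMap (ℝ × ℝ) ℂ := ∂_{((0, 1) : ℝ × ℝ)} f
  have hprod : ∀ {a c : ℝ}, |a| ≤ 1 → |c| ≤ 1 → |a * c| ≤ 1 := fun ha hc => by
    rw [abs_mul]
    exact mul_le_one₀ ha (abs_nonneg _) hc
  have w0 : ∀ θ : ℝ, |(fun _ : ℝ => (1 : ℝ)) θ| ≤ 1 := fun θ => by simp
  have w1 : ∀ θ : ℝ, |(fun θ => 1 * Real.cos θ) θ| ≤ 1 := fun θ => hprod (w0 θ) (abs_cos_le_one θ)
  have w2 : ∀ θ : ℝ, |(fun θ => 1 * Real.sin θ) θ| ≤ 1 := fun θ => hprod (w0 θ) (abs_sin_le_one θ)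
  have w11 : ∀ θ : ℝ, |(fun θ => 1 * Real.cos θ * Real.cos θ) θ| ≤ 1 :=
    fun θ => hprod (w1 θ) (abs_cos_le_one θ)
  have w12 : ∀ θ : ℝ, |(fun θ => 1 * Real.cos θ * Real.sin θ) θ| ≤ 1 :=
    fun θ => hprod (w1 θ) (abs_sin_le_one θ)
  have w21 : ∀ θ : ℝ, |(fun θ => 1 * Real.sin θ * Real.cos θ) θ| ≤ 1 :=
    fun θ => hprod (w2 θ) (abs_cos_le_one θ)
  have w22 : ∀ θ : ℝ, |(fun θ => 1 * Real.sin θ * Real.sin θ) θ| ≤ 1 :=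
    fun θ => hprod (w2 θ) (abs_sin_le_one θ)
  obtain ⟨M0, hM0, b0⟩ := exists_weightedCircleIntegral_decay w0 f x
  obtain ⟨M1, hM1, b1⟩ := exists_weightedCircleIntegral_decay w1 f₁ x
  obtain ⟨M2, hM2, b2⟩ := exists_weightedCircleIntegral_decay w2 f₂ x
  obtain ⟨M11, hM11, b11⟩ := exists_weightedCircleIntegral_decay w11 (∂_{((1, 0) : ℝ × ℝ)} f₁) x
  obtain ⟨M12, hM12, b12⟩ := exists_weightedCircleIntegral_decay w12 (∂_{((0, 1) : ℝ × ℝ)} f₁) x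
  obtain ⟨M21, hM21, b21⟩ := exists_weightedCircleIntegral_decay w21 (∂_{((1, 0) : ℝ × ℝ)} f₂) x
  obtain ⟨M22, hM22, b22⟩ := exists_weightedCircleIntegral_decay w22 (∂_{((0, 1) : ℝ × ℝ)} f₂) x
  have hq : circleRadon (fun p => f p) x =
      fun t => c * weightedCircleIntegral (fun _ => 1) f x t := by
    ext t
    simp [circleRadon, weightedCircleIntegral, hc]
  have hscale : ∀ {z : ℂ} {d : ℝ}, ‖z‖ ≤ d → ‖c * z‖ ≤ d := fun hz => by
    rw [norm_mul]
    exact (mul_le_of_le_one_left (norm_nonneg _) hcn).trans hz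
  have d0 := fun t => (hasDerivAt_weightedCircleIntegral continuous_const w0 f x t).const_mul c
  have d1 := fun t => ((hasDerivAt_weightedCircleIntegral (by fun_prop) w1 f₁ x t).add
      (hasDerivAt_weightedCircleIntegral (by fun_prop) w2 f₂ x t)).const_mul c
  have c11 := continuous_weightedCircleIntegral (by fun_prop) w11 (∂_{((1, 0) : ℝ × ℝ)} f₁) x
  have c12 := continuous_weightedCircleIntegral (by fun_prop) w12 (∂_{((0, 1) : ℝ × ℝ)} f₁) x
  have c21 := continuous_weightedCircleIntegral (by fun_prop) w21 (∂_{((1, 0) : ℝ × ℝ)} f₂) x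
  have c22 := continuous_weightedCircleIntegral (by fun_prop) w22 (∂_{((0, 1) : ℝ × ℝ)} f₂) x
  rw [hq]
  refine ⟨_, _, M0 + (M1 + M2) + (M11 + M12 + (M21 + M22)), by positivity, d0, d1,
    continuous_const.mul ((c11.add c12).add (c21.add c22)), fun t => ?_, fun t => ?_, fun t => ?_⟩
  · refine hscale ((b0 t).trans ?_)
    exact div_le_div_of_nonneg_right (by linarith) (by positivity)
  · refine hscale (((norm_add_le _ _).trans (add_le_add (b1 t) (b2 t))).trans ?_)
    rw [← add_div]
    exact div_le_div_of_nonneg_right (by linarith) (by positivity)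
  · refine hscale (((norm_add_le _ _).trans (add_le_add
      ((norm_add_le _ _).trans (add_le_add (b11 t) (b12 t)))
      ((norm_add_le _ _).trans (add_le_add (b21 t) (b22 t))))).trans ?_)
    rw [← add_div, ← add_div, ← add_div]
    exact div_le_div_of_nonneg_right (by linarith) (by positivity)

/-- **Recovery of the data `g` for radii `r > R` from the projections onto `o_range^{a,b}`.**
For `f` Schwartz on ℝ², `g = Rf`, `R > 0`: for every `x` and `r > R`, the inner integral
`∫_0^∞ cos(bs)·s·g(x,√(s²+R²)) ds` converges absolutely for each `b ≥ 0`, the resulting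
function of `b` is integrable on `(0,∞)`, and
`g(x,r) = (2/π)·(r²-R²)^{-1/2} ∫_0^∞ cos(b√(r²-R²))·(∫_0^∞ cos(bs)·s·g(x,√(s²+R²)) ds) db`. -/
theorem stmt15 (f : SchwartzMap (ℝ × ℝ) ℂ) (R : ℝ) (hR : 0 < R) (x r : ℝ) (hr : R < r) :
    (∀ b : ℝ, 0 ≤ b →
        MeasureTheory.IntegrableOn
          (fun s : ℝ =>
            ((Real.cos (b * s) * s : ℝ) : ℂ) *
              circleRadon (fun p => f p) x (Real.sqrt (s ^ 2 + R ^ 2)))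
          (Set.Ioi 0)) ∧
      MeasureTheory.IntegrableOn
        (fun b : ℝ =>
          ∫ s in Set.Ioi (0 : ℝ),
            ((Real.cos (b * s) * s : ℝ) : ℂ) *
              circleRadon (fun p => f p) x (Real.sqrt (s ^ 2 + R ^ 2)))
        (Set.Ioi 0) ∧
      circleRadon (fun p => f p) x r =
        ((2 / π * (Real.sqrt (r ^ 2 - R ^ 2))⁻¹ : ℝ) : ℂ) *
          ∫ b in Set.Ioi (0 : ℝ),
            ((Real.cos (b * Real.sqrt (r ^ 2 - R ^ 2)) : ℝ) : ℂ) *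
              ∫ s in Set.Ioi (0 : ℝ),
                ((Real.cos (b * s) * s : ℝ) : ℂ) *
                  circleRadon (fun p => f p) x (Real.sqrt (s ^ 2 + R ^ 2)) := by
  obtain ⟨q', q'', M, hM, hq, hq', hq''c, bq, bq', bq''⟩ := exists_circleRadon_derivatives f x
  obtain ⟨bk, K, hK⟩ := exists_profile_decay hR hM hq hq' hq''c bq bq' bq''
  set q : ℝ → ℂ := circleRadon (fun p => f p) x
  have hqc : Continuous q := continuous_iff_continuousAt.2 fun s => (hq s).continuousAt
  set H : ℝ → ℂ := fun s => ((|s| : ℝ) : ℂ) * q √(s ^ 2 + R ^ 2) with hHdef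
  have hHc : Continuous H := by simp only [hHdef]; fun_prop
  have hHeven : ∀ s, H (-s) = H s := fun s => by simp only [hHdef, abs_neg, neg_sq]
  have hHpos : ∀ s ∈ Set.Ioi (0 : ℝ), H s = (s : ℂ) * q √(s ^ 2 + R ^ 2) := fun s hs => by
    simp only [hHdef, abs_of_pos (Set.mem_Ioi.1 hs)]
  have hHint : Integrable H := by
    refine (integrable_inv_one_add_sq.const_mul (3 * M)).mono' hHc.aestronglyMeasurable
      (Eventually.of_forall fun s => ?_)
    have := bk s
    rw [norm_mul, Complex.norm_real] at this
    simpa [hHdef] using this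
  have hform : ∀ b, Set.EqOn
      (fun s : ℝ => ((Real.cos (b * s) : ℝ) : ℂ) * H s)
      (fun s : ℝ => ((Real.cos (b * s) * s : ℝ) : ℂ) * q √(s ^ 2 + R ^ 2)) (Set.Ioi 0) :=
    fun b s hs => by
      simp only [hHpos s hs]
      push_cast
      ring
  have hformInt : ∀ b, ∫ s in Set.Ioi (0 : ℝ),
      ((Real.cos (b * s) * s : ℝ) : ℂ) * q √(s ^ 2 + R ^ 2) =
      ∫ s in Set.Ioi (0 : ℝ), ((Real.cos (b * s) : ℝ) : ℂ) * H s := fun b =>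
    (setIntegral_congr_fun measurableSet_Ioi (hform b)).symm
  have hC : Integrable fun b : ℝ =>
      ∫ s in Set.Ioi (0 : ℝ), ((Real.cos (b * s) : ℝ) : ℂ) * H s := by
    refine (integrable_inv_one_add_sq.const_mul K).mono'
      (continuous_cosine_transform hHint).aestronglyMeasurable
      (Eventually.of_forall fun b => ?_)
    exact (congrArg norm (setIntegral_congr_fun measurableSet_Ioi
      fun s hs => by simp only [hHpos s hs])).trans_le (hK b)
  refine ⟨fun b _ => ((integrable_cos_mul hHint b).integrableOn).congr_fun (hform b)
    measurableSet_Ioi, ?_, ?_⟩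
  · simp only [hformInt]
    exact hC.integrableOn
  · simp only [hformInt]
    have hpos : 0 < r ^ 2 - R ^ 2 := by nlinarith
    have ht : 0 < √(r ^ 2 - R ^ 2) := sqrt_pos.2 hpos
    have hradius : √(√(r ^ 2 - R ^ 2) ^ 2 + R ^ 2) = r := by
      rw [sq_sqrt hpos.le, sub_add_cancel, sqrt_sq (hR.trans hr).le]
    have hinv := cosine_inversion hHint hHc hHeven hC √(r ^ 2 - R ^ 2)
    rw [hHpos _ ht, hradius] at hinv
    have htc : ((√(r ^ 2 - R ^ 2) : ℝ) : ℂ) ≠ 0 := by exact_mod_cast ht.ne'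
    rw [Complex.ofReal_mul, mul_comm ((2 / π : ℝ) : ℂ), mul_assoc, ← hinv, Complex.ofReal_inv,
      inv_mul_cancel_left₀ htc]
end
end
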